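/- arXiv:2312.11016 — 7 statements merged into one kernel-verified Lean document; each statement's English description precedes it below -/
import Mathlib

section
/- For every ω > 0 and every smooth function f : ℝ → ℝ, the conjugation identities S(S(L₊(L₋ f))) = M₊(M₋(S(S f))) and L₋(L₊(S*(S* f))) = S*(S*(M₋(M₊ f))) hold pointwise on ℝ. -/
open Real

/-- `a_ω = √(1 + 16ω/3)`. -/
noncomputable def aCoef (ω : ℝ) : ℝ := Real.sqrt (1 + 16 * ω / 3)

/-- The solitary wave profile `Q_ω(y) = √(4 / (1 + a_ω cosh 2y))`. -/
noncomputable def Q (ω : ℝ) (y : ℝ) : ℝ :=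
  Real.sqrt (4 / (1 + aCoef ω * Real.cosh (2 * y)))

/-- `L₊ f = -f'' + f - 3 Q_ω² f - 5 ω Q_ω⁴ f`. -/
noncomputable def Lp (ω : ℝ) (f : ℝ → ℝ) : ℝ → ℝ :=
  fun y => -(deriv (deriv f) y) + f y - 3 * (Q ω y) ^ 2 * f y - 5 * ω * (Q ω y) ^ 4 * f y

/-- `L₋ f = -f'' + f - Q_ω² f - ω Q_ω⁴ f`. -/
noncomputable def Lm (ω : ℝ) (f : ℝ → ℝ) : ℝ → ℝ :=
  fun y => -(deriv (deriv f) y) + f y - (Q ω y) ^ 2 * f y - ω * (Q ω y) ^ 4 * f y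

/-- `M₊ f = -f'' + f + (ω/3) Q_ω⁴ f`. -/
noncomputable def Mp (ω : ℝ) (f : ℝ → ℝ) : ℝ → ℝ :=
  fun y => -(deriv (deriv f) y) + f y + (ω / 3) * (Q ω y) ^ 4 * f y

/-- `M₋ f = -f'' + f - ω Q_ω⁴ f`. -/
noncomputable def Mm (ω : ℝ) (f : ℝ → ℝ) : ℝ → ℝ :=
  fun y => -(deriv (deriv f) y) + f y - ω * (Q ω y) ^ 4 * f y

/-- `S f = f' - (Q_ω'/Q_ω) f`. -/
noncomputable def S (ω : ℝ) (f : ℝ → ℝ) : ℝ → ℝ :=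
  fun y => deriv f y - (deriv (Q ω) y / Q ω y) * f y

/-- `S* f = -f' - (Q_ω'/Q_ω) f`. -/
noncomputable def Sstar (ω : ℝ) (f : ℝ → ℝ) : ℝ → ℝ :=
  fun y => -(deriv f y) - (deriv (Q ω) y / Q ω y) * f y

theorem aCoef_sq {ω : ℝ} (hω : 0 < ω) : aCoef ω ^ 2 = 1 + 16 * ω / 3 :=
  Real.sq_sqrt (by positivity)

theorem one_add_aCoef_mul_cosh_pos (ω y : ℝ) : 0 < 1 + aCoef ω * Real.cosh (2 * y) := by
  have h₁ : 0 ≤ aCoef ω := Real.sqrt_nonneg _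
  have h₂ := Real.cosh_pos (2 * y)
  positivity

theorem Q_sq (ω y : ℝ) : Q ω y ^ 2 = 4 / (1 + aCoef ω * Real.cosh (2 * y)) :=
  Real.sq_sqrt (div_nonneg (by norm_num) (one_add_aCoef_mul_cosh_pos ω y).le)

theorem Q_pos (ω y : ℝ) : 0 < Q ω y :=
  Real.sqrt_pos.2 (div_pos (by norm_num) (one_add_aCoef_mul_cosh_pos ω y))

/-- The logarithmic derivative `Q_ω' / Q_ω`. -/
noncomputable def logDerivQ (ω y : ℝ) : ℝ := deriv (Q ω) y / Q ω y

theorem hasDerivAt_one_add_aCoef_mul_cosh (ω y : ℝ) :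
    HasDerivAt (fun y => 1 + aCoef ω * Real.cosh (2 * y))
      (2 * aCoef ω * Real.sinh (2 * y)) y := by
  have h := ((((hasDerivAt_id y).const_mul 2).cosh).const_mul (aCoef ω)).const_add 1
  refine h.congr_deriv ?_
  simp only [id]
  ring

theorem logDerivQ_eq (ω y : ℝ) :
    logDerivQ ω y = -(aCoef ω * Real.sinh (2 * y)) / (1 + aCoef ω * Real.cosh (2 * y)) := by
  have hD := one_add_aCoef_mul_cosh_pos ω y
  have h := ((hasDerivAt_const y (4 : ℝ)).div (hasDerivAt_one_add_aCoef_mul_cosh ω y) hD.ne').sqrt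
    (div_pos (by norm_num) hD).ne'
  have hQ : deriv (Q ω) y = _ := h.deriv
  have hQ' : √(4 / (1 + aCoef ω * Real.cosh (2 * y))) = Q ω y := rfl
  have hsq := Q_sq ω y
  have hpos := Q_pos ω y
  simp only [Pi.div_apply, hQ'] at hQ
  rw [logDerivQ, hQ, div_div, mul_assoc 2 (Q ω y), ← sq, hsq]
  field_simp
  ring

theorem hasDerivAt_Q_sq (ω y : ℝ) :
    HasDerivAt (fun y => Q ω y ^ 2) (2 * logDerivQ ω y * Q ω y ^ 2) y := by
  have hD := one_add_aCoef_mul_cosh_pos ω y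
  have h := (hasDerivAt_const y (4 : ℝ)).div (hasDerivAt_one_add_aCoef_mul_cosh ω y) hD.ne'
  rw [funext (Q_sq ω)]
  refine h.congr_deriv ?_
  rw [logDerivQ_eq, Q_sq]
  field_simp
  ring

theorem logDerivQ_sq {ω : ℝ} (hω : 0 < ω) (y : ℝ) :
    logDerivQ ω y ^ 2 = 1 - Q ω y ^ 2 / 2 - ω / 3 * (Q ω y ^ 2) ^ 2 := by
  have hD := one_add_aCoef_mul_cosh_pos ω y
  rw [logDerivQ_eq, Q_sq]
  field_simp
  linear_combination -6 * aCoef_sq hω - 6 * aCoef ω ^ 2 * Real.cosh_sq (2 * y)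

theorem hasDerivAt_logDerivQ {ω : ℝ} (hω : 0 < ω) (y : ℝ) :
    HasDerivAt (logDerivQ ω) (-(Q ω y ^ 2) / 2 - 2 * ω / 3 * (Q ω y ^ 2) ^ 2) y := by
  have hD := one_add_aCoef_mul_cosh_pos ω y
  have hs := ((((hasDerivAt_id y).const_mul 2).sinh).const_mul (aCoef ω)).neg
  have h := hs.div (hasDerivAt_one_add_aCoef_mul_cosh ω y) hD.ne'
  rw [funext (logDerivQ_eq ω)]
  refine h.congr_deriv ?_
  rw [Q_sq]
  simp only [id, Pi.neg_apply]
  field_simp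
  linear_combination -12 * aCoef_sq hω - 12 * aCoef ω ^ 2 * Real.cosh_sq (2 * y)

theorem contDiff_logDerivQ (ω : ℝ) : ContDiff ℝ (⊤ : ℕ∞) (logDerivQ ω) := by
  rw [funext (logDerivQ_eq ω)]
  refine ContDiff.div ?_ ?_ fun y => (one_add_aCoef_mul_cosh_pos ω y).ne'
  · exact (contDiff_const.mul (Real.contDiff_sinh.comp (contDiff_const.mul contDiff_id))).neg
  · exact contDiff_const.add
      (contDiff_const.mul (Real.contDiff_cosh.comp (contDiff_const.mul contDiff_id)))

theorem contDiff_Q_sq (ω : ℝ) : ContDiff ℝ (⊤ : ℕ∞) (fun y => Q ω y ^ 2) := by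
  rw [funext (Q_sq ω)]
  refine ContDiff.div contDiff_const ?_ fun y => (one_add_aCoef_mul_cosh_pos ω y).ne'
  exact contDiff_const.add
    (contDiff_const.mul (Real.contDiff_cosh.comp (contDiff_const.mul contDiff_id)))

section Smooth

variable {ω : ℝ} {f : ℝ → ℝ}

theorem contDiff_deriv_of_smooth (hf : ContDiff ℝ (⊤ : ℕ∞) f) :
    ContDiff ℝ (⊤ : ℕ∞) (deriv f) :=
  (contDiff_infty_iff_deriv.1 hf).2

theorem hasDerivAt_of_smooth (hf : ContDiff ℝ (⊤ : ℕ∞) f) (y : ℝ) :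
    HasDerivAt f (deriv f y) y :=
  (contDiff_infty_iff_deriv.1 hf).1.differentiableAt.hasDerivAt

theorem S_eq (ω : ℝ) (f : ℝ → ℝ) : S ω f = fun y => deriv f y - logDerivQ ω y * f y := rfl

theorem Sstar_eq (ω : ℝ) (f : ℝ → ℝ) :
    Sstar ω f = fun y => -deriv f y - logDerivQ ω y * f y := rfl

theorem contDiff_S (hf : ContDiff ℝ (⊤ : ℕ∞) f) : ContDiff ℝ (⊤ : ℕ∞) (S ω f) :=
  (contDiff_deriv_of_smooth hf).sub ((contDiff_logDerivQ ω).mul hf)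

theorem contDiff_Sstar (hf : ContDiff ℝ (⊤ : ℕ∞) f) : ContDiff ℝ (⊤ : ℕ∞) (Sstar ω f) :=
  (contDiff_deriv_of_smooth hf).neg.sub ((contDiff_logDerivQ ω).mul hf)

theorem contDiff_Mm (hf : ContDiff ℝ (⊤ : ℕ∞) f) : ContDiff ℝ (⊤ : ℕ∞) (Mm ω f) := by
  have hQ : ContDiff ℝ (⊤ : ℕ∞) (fun y => Q ω y ^ 4) := by
    simpa only [← pow_mul] using (contDiff_Q_sq ω).pow 2
  exact ((contDiff_deriv_of_smooth (contDiff_deriv_of_smooth hf)).neg.add hf).sub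
    ((contDiff_const.mul hQ).mul hf)

theorem contDiff_Lp (hf : ContDiff ℝ (⊤ : ℕ∞) f) : ContDiff ℝ (⊤ : ℕ∞) (Lp ω f) := by
  have hQ : ContDiff ℝ (⊤ : ℕ∞) (fun y => Q ω y ^ 4) := by
    simpa only [← pow_mul] using (contDiff_Q_sq ω).pow 2
  exact (((contDiff_deriv_of_smooth (contDiff_deriv_of_smooth hf)).neg.add hf).sub
    ((contDiff_const.mul (contDiff_Q_sq ω)).mul hf)).sub ((contDiff_const.mul hQ).mul hf)

theorem hasDerivAt_S (hω : 0 < ω) (hf : ContDiff ℝ (⊤ : ℕ∞) f) (y : ℝ) :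
    HasDerivAt (S ω f) (deriv (deriv f) y
      - ((-(Q ω y ^ 2) / 2 - 2 * ω / 3 * (Q ω y ^ 2) ^ 2) * f y + logDerivQ ω y * deriv f y)) y :=
  (hasDerivAt_of_smooth (contDiff_deriv_of_smooth hf) y).sub
    ((hasDerivAt_logDerivQ hω y).mul (hasDerivAt_of_smooth hf y))

theorem hasDerivAt_Sstar (hω : 0 < ω) (hf : ContDiff ℝ (⊤ : ℕ∞) f) (y : ℝ) :
    HasDerivAt (Sstar ω f) (-deriv (deriv f) y
      - ((-(Q ω y ^ 2) / 2 - 2 * ω / 3 * (Q ω y ^ 2) ^ 2) * f y + logDerivQ ω y * deriv f y)) y :=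
  (hasDerivAt_of_smooth (contDiff_deriv_of_smooth hf) y).neg.sub
    ((hasDerivAt_logDerivQ hω y).mul (hasDerivAt_of_smooth hf y))

theorem Sstar_S (hω : 0 < ω) (hf : ContDiff ℝ (⊤ : ℕ∞) f) : Sstar ω (S ω f) = Lm ω f := by
  funext y
  rw [Sstar_eq, Lm]
  beta_reduce
  rw [(hasDerivAt_S hω hf y).deriv, S_eq]
  linear_combination f y * logDerivQ_sq hω y

theorem S_Sstar (hω : 0 < ω) (hf : ContDiff ℝ (⊤ : ℕ∞) f) : S ω (Sstar ω f) = Mp ω f := by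
  funext y
  rw [S_eq, Mp]
  beta_reduce
  rw [(hasDerivAt_Sstar hω hf y).deriv, Sstar_eq]
  linear_combination f y * logDerivQ_sq hω y

/-- The intertwining relation `S L₊ S* = S* M₋ S`. -/
theorem S_Lp_Sstar (hω : 0 < ω) (hf : ContDiff ℝ (⊤ : ℕ∞) f) :
    S ω (Lp ω (Sstar ω f)) = Sstar ω (Mm ω (S ω f)) := by
  have hf₁ := contDiff_deriv_of_smooth hf
  have hf₂ := contDiff_deriv_of_smooth hf₁
  have d₀ := hasDerivAt_of_smooth hf
  have d₁ := hasDerivAt_of_smooth hf₁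
  have d₂ := hasDerivAt_of_smooth hf₂
  have d₃ := hasDerivAt_of_smooth (contDiff_deriv_of_smooth hf₂)
  have dp := hasDerivAt_logDerivQ hω
  have du := hasDerivAt_Q_sq ω
  have dp' := fun y => ((du y).fun_neg.div_const 2).fun_sub
    (((du y).fun_pow 2).const_mul (2 * ω / 3))
  have dp'' := fun y => ((dp' y).fun_mul (d₀ y)).fun_add ((dp y).fun_mul (d₁ y))
  have e₁ := funext fun y => (hasDerivAt_Sstar hω hf y).deriv
  have e₂ := funext fun y => (hasDerivAt_S hω hf y).deriv
  have hL : Lp ω (Sstar ω f) = fun y => deriv (deriv (deriv f)) y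
      + logDerivQ ω y * deriv (deriv f) y
      + (2 * Q ω y ^ 2 + 11 * ω / 3 * (Q ω y ^ 2) ^ 2 - 1) * deriv f y
      + logDerivQ ω y * (2 * Q ω y ^ 2 + 7 * ω / 3 * (Q ω y ^ 2) ^ 2 - 1) * f y := by
    funext y
    rw [Lp, e₁, ((d₂ y).fun_neg.fun_sub (dp'' y)).deriv, Sstar_eq]
    ring
  have hM : Mm ω (S ω f) = fun y => -deriv (deriv (deriv f)) y
      + logDerivQ ω y * deriv (deriv f) y
      + (1 - Q ω y ^ 2 - 7 * ω / 3 * (Q ω y ^ 2) ^ 2) * deriv f y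
      + logDerivQ ω y * (-1 - Q ω y ^ 2 - 5 * ω / 3 * (Q ω y ^ 2) ^ 2) * f y := by
    funext y
    rw [Mm, e₂, ((d₂ y).fun_sub (dp'' y)).deriv, S_eq]
    ring
  funext y
  have dQ (a b : ℝ) := ((du y).const_mul a).fun_add (((du y).fun_pow 2).const_mul b)
  have dL := (((d₃ y).fun_add ((dp y).fun_mul (d₂ y))).fun_add
    (((dQ 2 (11 * ω / 3)).sub_const 1).fun_mul (d₁ y))).fun_add
    (((dp y).fun_mul ((dQ 2 (7 * ω / 3)).sub_const 1)).fun_mul (d₀ y))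
  have dM := (((d₃ y).fun_neg.fun_add ((dp y).fun_mul (d₂ y))).fun_add
    ((((du y).const_sub 1).fun_sub (((du y).fun_pow 2).const_mul (7 * ω / 3))).fun_mul
      (d₁ y))).fun_add
    (((dp y).fun_mul (((du y).const_sub (-1)).fun_sub
      (((du y).fun_pow 2).const_mul (5 * ω / 3)))).fun_mul (d₀ y))
  rw [hL, hM, S_eq, Sstar_eq]
  simp only [dL.deriv, dM.deriv]
  linear_combination (-(Q ω y ^ 2) - 4 * ω / 3 * (Q ω y ^ 2) ^ 2) * f y * logDerivQ_sq hω y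

end Smooth

/-- The conjugation identities `S² L₊ L₋ = M₊ M₋ S²` and `L₋ L₊ (S*)² = (S*)² M₋ M₊`. -/
theorem conjugation_identities (ω : ℝ) (hω : 0 < ω) (f : ℝ → ℝ) (hf : ContDiff ℝ (⊤ : ℕ∞) f) :
    (∀ y : ℝ, S ω (S ω (Lp ω (Lm ω f))) y = Mp ω (Mm ω (S ω (S ω f))) y) ∧
    (∀ y : ℝ, Lm ω (Lp ω (Sstar ω (Sstar ω f))) y = Sstar ω (Sstar ω (Mm ω (Mp ω f))) y) := by
  have hS := contDiff_S (ω := ω) hf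
  have hT := contDiff_Sstar (ω := ω) hf
  constructor
  · intro y
    rw [← Sstar_S hω hf, S_Lp_Sstar hω hS, S_Sstar hω (contDiff_Mm (contDiff_S hS))]
  · intro y
    rw [← Sstar_S hω (contDiff_Lp (contDiff_Sstar hT)), S_Lp_Sstar hω hT, S_Sstar hω hf]
end

section
/- There exist constants C > 0 and ω₁ > 0 such that for every ω ∈ (0, ω₁) there exist a real number α ∈ (0, 1) with |α − 8ω/9| ≤ C·ω², and smooth even functions W₁, W₂ : ℝ → ℝ satisfying the eigenvalue system M₊W₁ = (1 − α²)·W₂ and M₋W₂ = (1 − α²)·W₁ on ℝ, together with the asymptotic bounds |W₁(y) − e^{−α|y|}| ≤ C·ω·e^{−α|y|} and |W₂(y) − e^{−α|y|}| ≤ C·ω·e^{−α|y|} for all y ∈ ℝ (in particular W₁ and W₂ are positive and square-integrable). -/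
open Real

namespace InternalMode

open Filter Topology MeasureTheory Set
open scoped BoundedContinuousFunction

/-- A family of kernels `N ω α y z`, for `ω ∈ (0, 1)` and `|α| ≤ 1/4`, that is jointly continuous in
`(y, z)`, invariant under `(y, z) ↦ (-y, -z)`, of size `O(e^{m|z|})`, and Lipschitz in `α` with
constant `O(e^{m|z|})`, all uniformly in `ω`. -/
def IsKernel (m : ℝ) (N : ℝ → ℝ → ℝ → ℝ → ℝ) : Prop :=
  ∃ D : ℝ, 0 ≤ D ∧ ∀ ω ∈ Ioo (0 : ℝ) 1, ∀ α : ℝ, |α| ≤ 1 / 4 →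
    Continuous (fun p : ℝ × ℝ => N ω α p.1 p.2) ∧
    (∀ y z, N ω α (-y) (-z) = N ω α y z) ∧
    (∀ y z, |N ω α y z| ≤ D * exp (m * |z|)) ∧
    (∀ β : ℝ, |β| ≤ 1 / 4 → ∀ y z, |N ω α y z - N ω β y z| ≤ D * |α - β| * exp (m * |z|))

namespace IsKernel

variable {m m' : ℝ} {N N' : ℝ → ℝ → ℝ → ℝ → ℝ}

lemma mono (h : IsKernel m N) (hm : m ≤ m') : IsKernel m' N := by
  obtain ⟨D, hD, h⟩ := h
  refine ⟨D, hD, fun ω hω α hα => ?_⟩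
  obtain ⟨h1, h2, h3, h4⟩ := h ω hω α hα
  have hexp (z : ℝ) : exp (m * |z|) ≤ exp (m' * |z|) := by gcongr
  refine ⟨h1, h2, fun y z => (h3 y z).trans ?_, fun β hβ y z => (h4 β hβ y z).trans ?_⟩
  · exact mul_le_mul_of_nonneg_left (hexp z) hD
  · exact mul_le_mul_of_nonneg_left (hexp z) (by positivity)

lemma add (h : IsKernel m N) (h' : IsKernel m N') :
    IsKernel m (fun ω α y z => N ω α y z + N' ω α y z) := by
  obtain ⟨D, hD, h⟩ := h
  obtain ⟨D', hD', h'⟩ := h'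
  refine ⟨D + D', by positivity, fun ω hω α hα => ?_⟩
  obtain ⟨h1, h2, h3, h4⟩ := h ω hω α hα
  obtain ⟨h1', h2', h3', h4'⟩ := h' ω hω α hα
  refine ⟨h1.add h1', fun y z => by simp only [h2, h2'], fun y z => ?_, fun β hβ y z => ?_⟩
  · rw [add_mul]
    exact (abs_add_le _ _).trans (add_le_add (h3 y z) (h3' y z))
  · rw [add_mul, add_mul, add_sub_add_comm]
    exact (abs_add_le _ _).trans (add_le_add (h4 β hβ y z) (h4' β hβ y z))

lemma mul (h : IsKernel m N) (h' : IsKernel m' N') :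
    IsKernel (m + m') (fun ω α y z => N ω α y z * N' ω α y z) := by
  obtain ⟨D, hD, h⟩ := h
  obtain ⟨D', hD', h'⟩ := h'
  refine ⟨2 * (D * D'), by positivity, fun ω hω α hα => ?_⟩
  obtain ⟨h1, h2, h3, h4⟩ := h ω hω α hα
  obtain ⟨h1', h2', h3', h4'⟩ := h' ω hω α hα
  have hexp (z : ℝ) : exp ((m + m') * |z|) = exp (m * |z|) * exp (m' * |z|) := by
    rw [← exp_add, add_mul]
  refine ⟨h1.mul h1', fun y z => by simp only [h2, h2'], fun y z => ?_, fun β hβ y z => ?_⟩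
  · rw [abs_mul, hexp]
    calc |N ω α y z| * |N' ω α y z|
        ≤ (D * exp (m * |z|)) * (D' * exp (m' * |z|)) := by
          gcongr
          exacts [h3 y z, h3' y z]
      _ ≤ 2 * (D * D') * (exp (m * |z|) * exp (m' * |z|)) := by
          have : 0 ≤ D * D' * (exp (m * |z|) * exp (m' * |z|)) := by positivity
          linarith
  · obtain ⟨-, -, h3β, -⟩ := h ω hω β hβ
    rw [hexp, show N ω α y z * N' ω α y z - N ω β y z * N' ω β y z
      = (N ω α y z - N ω β y z) * N' ω α y z + N ω β y z * (N' ω α y z - N' ω β y z) by ring]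
    refine (abs_add_le _ _).trans ?_
    rw [abs_mul, abs_mul]
    calc |N ω α y z - N ω β y z| * |N' ω α y z| + |N ω β y z| * |N' ω α y z - N' ω β y z|
        ≤ (D * |α - β| * exp (m * |z|)) * (D' * exp (m' * |z|))
          + (D * exp (m * |z|)) * (D' * |α - β| * exp (m' * |z|)) := by
          gcongr
          exacts [h4 β hβ y z, h3' y z, h3β y z, h4' β hβ y z]
      _ = 2 * (D * D') * |α - β| * (exp (m * |z|) * exp (m' * |z|)) := by ring

lemma const_mul (h : IsKernel m N) (c : ℝ) : IsKernel m (fun ω α y z => c * N ω α y z) := by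
  obtain ⟨D, hD, h⟩ := h
  refine ⟨|c| * D, by positivity, fun ω hω α hα => ?_⟩
  obtain ⟨h1, h2, h3, h4⟩ := h ω hω α hα
  refine ⟨continuous_const.mul h1, fun y z => by simp only [h2], fun y z => ?_, fun β hβ y z => ?_⟩
  · rw [abs_mul, mul_assoc]
    exact mul_le_mul_of_nonneg_left (h3 y z) (abs_nonneg c)
  · rw [← mul_sub, abs_mul, mul_assoc, mul_assoc, ← mul_assoc D]
    exact mul_le_mul_of_nonneg_left (h4 β hβ y z) (abs_nonneg c)

end IsKernel

lemma abs_exp_sub_exp_le {a b M : ℝ} (ha : a ≤ M) (hb : b ≤ M) :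
    |exp a - exp b| ≤ |a - b| * exp M := by
  wlog hab : b ≤ a generalizing a b
  · rw [abs_sub_comm, abs_sub_comm a]
    exact this hb ha (le_of_not_ge hab)
  rw [abs_of_nonneg (sub_nonneg.2 (exp_le_exp.2 hab)), abs_of_nonneg (sub_nonneg.2 hab)]
  have h1 : exp b = exp a * exp (b - a) := by rw [← exp_add]; ring_nf
  have h2 := add_one_le_exp (b - a)
  calc exp a - exp b = exp a * (1 - exp (b - a)) := by rw [h1]; ring
    _ ≤ exp a * (a - b) := mul_le_mul_of_nonneg_left (by linarith) (exp_pos a).le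
    _ ≤ exp M * (a - b) := mul_le_mul_of_nonneg_right (exp_le_exp.2 ha) (by linarith)
    _ = _ := mul_comm _ _

lemma le_exp_self (t : ℝ) : t ≤ exp t := by linarith [add_one_le_exp t]

lemma isKernel_exp (c d : ℝ) :
    IsKernel (|c| / 4 + d + 1) (fun _ α _ z => exp ((c * α + d) * |z|)) := by
  have hle (α z : ℝ) (hα : |α| ≤ 1 / 4) : (c * α + d) * |z| ≤ (|c| / 4 + d) * |z| := by
    have h1 : c * α ≤ |c| * |α| := by rw [← abs_mul]; exact le_abs_self _
    have h2 : |c| * |α| ≤ |c| * (1 / 4) := by gcongr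
    gcongr
    linarith
  refine ⟨1 + |c|, by positivity, fun ω _ α hα => ⟨by fun_prop, by simp, fun y z => ?_,
    fun β hβ y z => ?_⟩⟩
  · rw [abs_of_pos (exp_pos _)]
    calc exp ((c * α + d) * |z|) ≤ exp ((|c| / 4 + d + 1) * |z|) := by
          apply exp_le_exp.2
          linarith [hle α z hα, abs_nonneg z]
      _ ≤ (1 + |c|) * exp ((|c| / 4 + d + 1) * |z|) :=
          le_mul_of_one_le_left (exp_pos _).le (by linarith [abs_nonneg c])
  · refine (abs_exp_sub_exp_le (hle α z hα) (hle β z hβ)).trans ?_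
    rw [show (c * α + d) * |z| - (c * β + d) * |z| = c * (α - β) * |z| by ring, abs_mul, abs_mul,
      abs_abs, show (|c| / 4 + d + 1) * |z| = |z| + (|c| / 4 + d) * |z| by ring, exp_add]
    calc |c| * |α - β| * |z| * exp ((|c| / 4 + d) * |z|)
        ≤ (1 + |c|) * |α - β| * exp |z| * exp ((|c| / 4 + d) * |z|) := by
          gcongr
          · linarith
          · exact le_exp_self _
      _ = _ := by ring

/-- The potential `Q_ω⁴`. -/
noncomputable def pot (ω y : ℝ) : ℝ := 16 / (1 + aCoef ω * cosh (2 * y)) ^ 2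

lemma one_le_aCoef {ω : ℝ} (hω : 0 ≤ ω) : 1 ≤ aCoef ω := by
  rw [aCoef, one_le_sqrt]
  linarith

lemma pot_denom_pos {ω : ℝ} (hω : 0 ≤ ω) (y : ℝ) : 0 < 1 + aCoef ω * cosh (2 * y) := by
  have := one_le_aCoef hω
  have := cosh_pos (2 * y)
  positivity

lemma Q_pow_four {ω : ℝ} (hω : 0 ≤ ω) (y : ℝ) : Q ω y ^ 4 = pot ω y := by
  have := pot_denom_pos hω y
  rw [Q, pot, show (4 : ℕ) = 2 * 2 from rfl, pow_mul, sq_sqrt (by positivity), div_pow]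
  norm_num

lemma pot_nonneg (ω y : ℝ) : 0 ≤ pot ω y := by unfold pot; positivity

lemma pot_neg (ω y : ℝ) : pot ω (-y) = pot ω y := by simp [pot]

lemma contDiff_pot {ω : ℝ} (hω : 0 ≤ ω) {n : ℕ} : ContDiff ℝ n (pot ω) := by
  unfold pot
  refine contDiff_const.div (ContDiff.pow (contDiff_const.add (contDiff_const.mul
    (contDiff_cosh.comp (contDiff_const.mul contDiff_id)))) 2) fun y => ?_
  exact pow_ne_zero _ (pot_denom_pos hω y).ne'

lemma continuous_pot {ω : ℝ} (hω : 0 ≤ ω) : Continuous (pot ω) :=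
  (contDiff_pot hω (n := 0)).continuous

lemma pot_le {ω : ℝ} (hω : 0 ≤ ω) (z : ℝ) : pot ω z ≤ 64 * exp (-4 * |z|) := by
  have ha := one_le_aCoef hω
  have hcosh : exp (2 * |z|) / 2 ≤ cosh (2 * z) := by
    rw [← cosh_abs, abs_mul, abs_two, cosh_eq]
    linarith [exp_pos (-(2 * |z|))]
  have h1 : exp (2 * |z|) / 2 ≤ 1 + aCoef ω * cosh (2 * z) := by
    nlinarith [cosh_pos (2 * z)]
  have h2 : exp (-4 * |z|) = 1 / exp (2 * |z|) ^ 2 := by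
    rw [one_div, ← exp_nat_mul, ← exp_neg]; congr 1; push_cast; ring
  rw [pot, h2]
  calc 16 / (1 + aCoef ω * cosh (2 * z)) ^ 2 ≤ 16 / (exp (2 * |z|) / 2) ^ 2 := by gcongr
    _ = 64 * (1 / exp (2 * |z|) ^ 2) := by field_simp; norm_num

lemma isKernel_pot : IsKernel (-4) (fun ω _ _ z => pot ω z) := by
  refine ⟨64, by norm_num, fun ω hω α _ => ⟨(continuous_pot hω.1.le).comp continuous_snd,
    fun y z => pot_neg ω z, fun y z => ?_, fun β _ y z => ?_⟩⟩
  · rw [abs_of_nonneg (pot_nonneg ω z)]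
    exact pot_le hω.1.le z
  · rw [sub_self, abs_zero]
    positivity

/-- `(1 - e^{-2αs}) / (2α)`, extended continuously to `α = 0`. -/
noncomputable def volt (α s : ℝ) : ℝ := ∫ t in (0 : ℝ)..s, exp (-2 * α * t)

lemma volt_eq {α : ℝ} (hα : α ≠ 0) (s : ℝ) : volt α s = (1 - exp (-2 * α * s)) / (2 * α) := by
  have h : ∀ t ∈ uIcc 0 s,
      HasDerivAt (fun t => -exp (-2 * α * t) / (2 * α)) (exp (-2 * α * t)) t := by
    intro t _
    refine ((((hasDerivAt_id t).const_mul (-2 * α)).exp.neg).div_const (2 * α)).congr_deriv ?_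
    simp only [id, mul_one]
    field_simp
  rw [volt, intervalIntegral.integral_eq_sub_of_hasDerivAt h
    (Continuous.intervalIntegrable (by fun_prop) _ _)]
  simp
  ring

lemma continuous_volt (α : ℝ) : Continuous (volt α) :=
  intervalIntegral.continuous_primitive
    (fun a b => Continuous.intervalIntegrable (by fun_prop) a b) 0

lemma abs_volt_le {α s : ℝ} (hα : |α| ≤ 1 / 4) (hs : 0 ≤ s) : |volt α s| ≤ s * exp (s / 2) := by
  have h : ∀ t ∈ uIoc 0 s, ‖exp (-2 * α * t)‖ ≤ exp (s / 2) := by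
    intro t ht
    rw [uIoc_of_le hs] at ht
    rw [norm_eq_abs, abs_of_pos (exp_pos _), exp_le_exp]
    nlinarith [(abs_le.1 hα).1, ht.1, ht.2]
  have := intervalIntegral.norm_integral_le_of_norm_le_const h
  rw [sub_zero, abs_of_nonneg hs] at this
  rw [mul_comm]
  exact this

lemma abs_volt_sub_volt_le {α β s : ℝ} (hα : |α| ≤ 1 / 4) (hβ : |β| ≤ 1 / 4) (hs : 0 ≤ s) :
    |volt α s - volt β s| ≤ 2 * |α - β| * s ^ 2 * exp (s / 2) := by
  have h : ∀ t ∈ uIoc 0 s,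
      ‖exp (-2 * α * t) - exp (-2 * β * t)‖ ≤ 2 * |α - β| * s * exp (s / 2) := by
    intro t ht
    rw [uIoc_of_le hs] at ht
    refine (abs_exp_sub_exp_le (M := s / 2) ?_ ?_).trans ?_
    · nlinarith [(abs_le.1 hα).1, ht.1, ht.2]
    · nlinarith [(abs_le.1 hβ).1, ht.1, ht.2]
    · rw [show -2 * α * t - -2 * β * t = -2 * (α - β) * t by ring, abs_mul, abs_mul,
        abs_of_pos ht.1]
      norm_num
      gcongr
      exact ht.2
  have := intervalIntegral.norm_integral_le_of_norm_le_const h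
  rw [intervalIntegral.integral_sub (Continuous.intervalIntegrable (by fun_prop) _ _)
    (Continuous.intervalIntegrable (by fun_prop) _ _), sub_zero, abs_of_nonneg hs] at this
  calc |volt α s - volt β s| ≤ _ := this
    _ = _ := by ring

lemma isKernel_volt : IsKernel (3 / 2) (fun _ α y z => volt α (max (|z| - |y|) 0)) := by
  have hs (y z : ℝ) : max (|z| - |y|) 0 ≤ |z| :=
    max_le (by linarith [abs_nonneg y]) (abs_nonneg z)
  have hexp (z : ℝ) : exp (3 / 2 * |z|) = exp |z| * exp (|z| / 2) := by
    rw [← exp_add]; ring_nf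
  refine ⟨4, by norm_num, fun ω _ α hα => ⟨(continuous_volt α).comp (by fun_prop), by simp,
    fun y z => ?_, fun β hβ y z => ?_⟩⟩
  · refine (abs_volt_le hα (le_max_right _ _)).trans ?_
    rw [hexp]
    calc max (|z| - |y|) 0 * exp (max (|z| - |y|) 0 / 2) ≤ |z| * exp (|z| / 2) := by
          gcongr <;> exact hs y z
      _ ≤ exp |z| * exp (|z| / 2) := by gcongr; exact le_exp_self _
      _ ≤ 4 * (exp |z| * exp (|z| / 2)) := by
          linarith [mul_pos (exp_pos |z|) (exp_pos (|z| / 2))]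
  · refine (abs_volt_sub_volt_le hα hβ (le_max_right _ _)).trans ?_
    have hsq : |z| ^ 2 ≤ 2 * exp |z| := by
      linarith [quadratic_le_exp_of_nonneg (abs_nonneg z), abs_nonneg z]
    rw [hexp]
    calc 2 * |α - β| * max (|z| - |y|) 0 ^ 2 * exp (max (|z| - |y|) 0 / 2)
        ≤ 2 * |α - β| * |z| ^ 2 * exp (|z| / 2) := by gcongr <;> exact hs y z
      _ ≤ 2 * |α - β| * (2 * exp |z|) * exp (|z| / 2) := by gcongr
      _ = _ := by ring

/-- The decay rate `√(2 - α²)` of the component `(W₁ - W₂) / 2`. -/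
noncomputable def rate (α : ℝ) : ℝ := √(2 - α ^ 2)

lemma one_le_rate {α : ℝ} (hα : |α| ≤ 1 / 4) : 1 ≤ rate α := by
  rw [rate, one_le_sqrt]
  nlinarith [abs_le.1 hα, sq_abs α, abs_nonneg α]

lemma rate_sq {α : ℝ} (hα : |α| ≤ 1 / 4) : rate α ^ 2 = 2 - α ^ 2 := by
  rw [rate, sq_sqrt]
  nlinarith [abs_le.1 hα, sq_abs α, abs_nonneg α]

lemma abs_rate_sub_rate_le {α β : ℝ} (hα : |α| ≤ 1 / 4) (hβ : |β| ≤ 1 / 4) :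
    |rate α - rate β| ≤ |α - β| := by
  have h1 := one_le_rate hα
  have h2 := one_le_rate hβ
  have h : (rate α - rate β) * (rate α + rate β) = (β - α) * (α + β) := by
    linarith [rate_sq hα, rate_sq hβ]
  have h' : |rate α - rate β| * (rate α + rate β) = |α - β| * |α + β| := by
    rw [← abs_of_pos (show 0 < rate α + rate β by linarith), ← abs_mul, h, abs_mul,
      abs_sub_comm]
  have h3 : |α + β| ≤ 1 := (abs_add_le _ _).trans (by linarith)
  nlinarith [abs_nonneg (rate α - rate β), abs_nonneg (α - β)]

lemma abs_green_sub_green_le {a b s : ℝ} (ha : 1 ≤ a) (hb : 1 ≤ b) (hs : 0 ≤ s) :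
    |exp (-a * s) / (2 * a) - exp (-b * s) / (2 * b)| ≤ |a - b| * ((s + 1) * exp (-s)) := by
  have hi : |(2 * a)⁻¹ - (2 * b)⁻¹| ≤ |a - b| := by
    rw [inv_sub_inv (by positivity) (by positivity), abs_div,
      abs_of_pos (show 0 < 2 * a * (2 * b) by positivity),
      div_le_iff₀ (by positivity), ← mul_sub, abs_mul, abs_two, abs_sub_comm]
    have : 1 ≤ a * b := by nlinarith
    nlinarith [abs_nonneg (a - b)]
  have he : |exp (-a * s) - exp (-b * s)| ≤ |a - b| * s * exp (-s) := by
    refine (abs_exp_sub_exp_le (M := -s) (by nlinarith) (by nlinarith)).trans_eq ?_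
    rw [show -a * s - -b * s = (b - a) * s by ring, abs_mul, abs_of_nonneg hs, abs_sub_comm]
  have hle : exp (-b * s) ≤ exp (-s) := exp_le_exp.2 (by nlinarith)
  have hinv : |(2 * a)⁻¹| ≤ 1 := by
    rw [abs_of_pos (by positivity)]
    exact inv_le_one_of_one_le₀ (by linarith)
  rw [show exp (-a * s) / (2 * a) - exp (-b * s) / (2 * b)
    = (exp (-a * s) - exp (-b * s)) * (2 * a)⁻¹ + exp (-b * s) * ((2 * a)⁻¹ - (2 * b)⁻¹) by ring]
  refine (abs_add_le _ _).trans ?_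
  rw [abs_mul, abs_mul, abs_of_pos (exp_pos _)]
  calc |exp (-a * s) - exp (-b * s)| * |(2 * a)⁻¹| + exp (-b * s) * |(2 * a)⁻¹ - (2 * b)⁻¹|
      ≤ |a - b| * s * exp (-s) * 1 + exp (-s) * |a - b| := by gcongr
    _ = _ := by ring

lemma isKernel_green : IsKernel (1 / 2) (fun _ α y z =>
    exp (1 / 2 * |y|) * (exp (-rate α * |y - z|) / (2 * rate α))) := by
  have hw (y z : ℝ) : exp (1 / 2 * |y|) * exp (-|y - z|) ≤
      exp (1 / 2 * |z|) * exp (-(|y - z| / 2)) := by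
    rw [← exp_add, ← exp_add, exp_le_exp]
    have := abs_add_le (y - z) z
    rw [sub_add_cancel] at this
    linarith
  refine ⟨2, by norm_num, fun ω _ α hα => ⟨?_, fun y z => ?_, fun y z => ?_, fun β hβ y z => ?_⟩⟩
  · have := one_le_rate hα
    fun_prop
  · simp only
    rw [abs_neg, show -y - -z = -(y - z) by ring, abs_neg]
  · have h1 := one_le_rate hα
    rw [abs_of_pos (by positivity)]
    have h2 : exp (-rate α * |y - z|) / (2 * rate α) ≤ exp (-|y - z|) := by
      refine (div_le_self (exp_pos _).le (by linarith)).trans (exp_le_exp.2 ?_)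
      nlinarith [abs_nonneg (y - z)]
    have h3 : exp (-(|y - z| / 2)) ≤ 1 := exp_le_one_iff.2 (by linarith [abs_nonneg (y - z)])
    calc exp (1 / 2 * |y|) * (exp (-rate α * |y - z|) / (2 * rate α))
        ≤ exp (1 / 2 * |y|) * exp (-|y - z|) := by gcongr
      _ ≤ exp (1 / 2 * |z|) * exp (-(|y - z| / 2)) := hw y z
      _ ≤ exp (1 / 2 * |z|) * 1 := by gcongr
      _ ≤ 2 * exp (1 / 2 * |z|) := by linarith [exp_pos (1 / 2 * |z|)]
  · rw [← mul_sub, abs_mul, abs_of_pos (exp_pos _)]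
    have h1 : (|y - z| + 1) * exp (-(|y - z| / 2)) ≤ 2 := by
      rw [exp_neg, ← div_eq_mul_inv, div_le_iff₀ (exp_pos _)]
      linarith [add_one_le_exp (|y - z| / 2)]
    calc exp (1 / 2 * |y|) * |exp (-rate α * |y - z|) / (2 * rate α)
            - exp (-rate β * |y - z|) / (2 * rate β)|
        ≤ exp (1 / 2 * |y|) * (|rate α - rate β| * ((|y - z| + 1) * exp (-|y - z|))) := by
          gcongr
          exact abs_green_sub_green_le (one_le_rate hα) (one_le_rate hβ) (abs_nonneg _)
      _ = |rate α - rate β| * (|y - z| + 1) * (exp (1 / 2 * |y|) * exp (-|y - z|)) := by ring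
      _ ≤ |α - β| * (|y - z| + 1) * (exp (1 / 2 * |z|) * exp (-(|y - z| / 2))) := by
          refine mul_le_mul (mul_le_mul_of_nonneg_right (abs_rate_sub_rate_le hα hβ) ?_) (hw y z)
            ?_ ?_ <;> positivity
      _ = |α - β| * exp (1 / 2 * |z|) * ((|y - z| + 1) * exp (-(|y - z| / 2))) := by ring
      _ ≤ |α - β| * exp (1 / 2 * |z|) * 2 := by gcongr
      _ = _ := by ring

lemma integrable_exp_neg_mul_abs {c : ℝ} (hc : 0 < c) :
    Integrable (fun z : ℝ => exp (-c * |z|)) := by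
  rw [← integrableOn_univ, ← Iic_union_Ioi (a := (0 : ℝ))]
  refine IntegrableOn.union ?_ ?_
  · refine (integrableOn_exp_mul_Iic hc 0).congr_fun (fun z hz => ?_) measurableSet_Iic
    simp only [abs_of_nonpos (mem_Iic.1 hz), neg_mul_neg]
  · refine (exp_neg_integrableOn_Ioi 0 hc).congr_fun (fun z hz => ?_) measurableSet_Ioi
    simp only [abs_of_pos (mem_Ioi.1 hz)]

lemma integrable_of_abs_le_exp {h : ℝ → ℝ} (hh : Continuous h) {C : ℝ}
    (hC : ∀ z, |h z| ≤ C * exp (-1 * |z|)) : Integrable h :=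
  ((integrable_exp_neg_mul_abs one_pos).const_mul C).mono' hh.aestronglyMeasurable
    (Eventually.of_forall hC)

/-- The space of triples `(α, U, V)`. -/
abbrev Triple : Type := ℝ × (ℝ →ᵇ ℝ) × (ℝ →ᵇ ℝ)

/-- The solution triple in the limit `ω → 0`. -/
noncomputable def base : Triple := (0, 1, 0)

lemma abs_fst_le {x : Triple} {r : ℝ} (hx : ‖x - base‖ ≤ r) : |x.1| ≤ r := by
  have := (norm_fst_le (x - base)).trans hx
  simpa [base] using this

lemma norm_snd_fst_sub_one_le {x : Triple} {r : ℝ} (hx : ‖x - base‖ ≤ r) : ‖x.2.1 - 1‖ ≤ r :=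
  ((norm_fst_le (x - base).2).trans (norm_snd_le _)).trans hx

lemma norm_snd_snd_le {x : Triple} {r : ℝ} (hx : ‖x - base‖ ≤ r) : ‖x.2.2‖ ≤ r := by
  have := ((norm_snd_le (x - base).2).trans (norm_snd_le _)).trans hx
  simpa [base] using this

lemma abs_snd_fst_le {x : Triple} (hx : ‖x - base‖ ≤ 1 / 4) (z : ℝ) : |x.2.1 z| ≤ 2 := by
  have h1 := ((x.2.1 - 1).norm_coe_le_norm z).trans (norm_snd_fst_sub_one_le hx)
  simp only [BoundedContinuousFunction.coe_sub, Pi.sub_apply, BoundedContinuousFunction.coe_one,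
    Pi.one_apply, norm_eq_abs] at h1
  rw [abs_le] at h1 ⊢
  constructor <;> linarith

lemma abs_snd_snd_le {x : Triple} (hx : ‖x - base‖ ≤ 1 / 4) (z : ℝ) : |x.2.2 z| ≤ 2 :=
  ((x.2.2.norm_coe_le_norm z).trans (norm_snd_snd_le hx)).trans (by norm_num)

/-- Triples whose function components are even. -/
def evenTriples : Set Triple := {x | ∀ y, x.2.1 (-y) = x.2.1 y ∧ x.2.2 (-y) = x.2.2 y}

lemma isClosed_evenTriples : IsClosed evenTriples := by
  have heval (y : ℝ) : Continuous fun f : ℝ →ᵇ ℝ => f y :=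
    continuous_eval_const y
  have h1 (y : ℝ) : Continuous fun x : Triple => x.2.1 y :=
    (heval y).comp (continuous_fst.comp continuous_snd)
  have h2 (y : ℝ) : Continuous fun x : Triple => x.2.2 y :=
    (heval y).comp (continuous_snd.comp continuous_snd)
  simp only [evenTriples, ofPred_forall, ofPred_and]
  exact isClosed_iInter fun y =>
    (isClosed_eq (h1 _) (h1 _)).inter (isClosed_eq (h2 _) (h2 _))

/-- The integrand of the integral operator with kernels `N₁`, `N₂` applied to a triple. -/
noncomputable def pairing (N₁ N₂ : ℝ → ℝ → ℝ → ℝ → ℝ) (ω : ℝ) (x : Triple) (y z : ℝ) : ℝ :=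
  N₁ ω x.1 y z * x.2.1 z + N₂ ω x.1 y z * x.2.2 z

lemma exists_pairing_bound {N₁ N₂ : ℝ → ℝ → ℝ → ℝ → ℝ}
    (h₁ : IsKernel (-1) N₁) (h₂ : IsKernel (-1) N₂) :
    ∃ D : ℝ, 0 ≤ D ∧ ∀ ω ∈ Ioo (0 : ℝ) 1, ∀ x : Triple, ‖x - base‖ ≤ 1 / 4 →
      Continuous (fun p : ℝ × ℝ => pairing N₁ N₂ ω x p.1 p.2) ∧
      (x ∈ evenTriples → ∀ y z, pairing N₁ N₂ ω x (-y) (-z) = pairing N₁ N₂ ω x y z) ∧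
      (∀ y z, |pairing N₁ N₂ ω x y z| ≤ D * exp (-1 * |z|)) ∧
      ∀ x' : Triple, ‖x' - base‖ ≤ 1 / 4 → ∀ y z,
        |pairing N₁ N₂ ω x y z - pairing N₁ N₂ ω x' y z| ≤ D * ‖x - x'‖ * exp (-1 * |z|) := by
  obtain ⟨D₁, hD₁, h₁⟩ := h₁
  obtain ⟨D₂, hD₂, h₂⟩ := h₂
  refine ⟨3 * (D₁ + D₂), by positivity, fun ω hω x hx => ?_⟩
  obtain ⟨c₁, e₁, b₁, l₁⟩ := h₁ ω hω x.1 (abs_fst_le hx)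
  obtain ⟨c₂, e₂, b₂, l₂⟩ := h₂ ω hω x.1 (abs_fst_le hx)
  have hU := abs_snd_fst_le hx
  have hV := abs_snd_snd_le hx
  refine ⟨?_, fun hev y z => ?_, fun y z => ?_, fun x' hx' y z => ?_⟩
  · exact (c₁.mul (x.2.1.continuous.comp continuous_snd)).add
      (c₂.mul (x.2.2.continuous.comp continuous_snd))
  · simp only [pairing, e₁, e₂, (hev z).1, (hev z).2]
  · refine (abs_add_le _ _).trans ?_
    rw [abs_mul, abs_mul]
    calc |N₁ ω x.1 y z| * |x.2.1 z| + |N₂ ω x.1 y z| * |x.2.2 z|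
        ≤ (D₁ * exp (-1 * |z|)) * 2 + (D₂ * exp (-1 * |z|)) * 2 := by
          gcongr
          exacts [b₁ y z, hU z, b₂ y z, hV z]
      _ ≤ _ := by
          have : 0 ≤ (D₁ + D₂) * exp (-1 * |z|) := by positivity
          linarith
  · have hU' := abs_snd_fst_le hx'
    have hV' := abs_snd_snd_le hx'
    have hα : |x.1 - x'.1| ≤ ‖x - x'‖ := norm_fst_le (x - x')
    have hdU : |x.2.1 z - x'.2.1 z| ≤ ‖x - x'‖ :=
      ((x - x').2.1.norm_coe_le_norm z).trans ((norm_fst_le _).trans (norm_snd_le _))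
    have hdV : |x.2.2 z - x'.2.2 z| ≤ ‖x - x'‖ :=
      ((x - x').2.2.norm_coe_le_norm z).trans ((norm_snd_le _).trans (norm_snd_le _))
    have key (a a' u u' D : ℝ) (ha : |a| ≤ D * exp (-1 * |z|))
        (hl : |a - a'| ≤ D * |x.1 - x'.1| * exp (-1 * |z|)) (hD : 0 ≤ D)
        (hu' : |u'| ≤ 2) (hdu : |u - u'| ≤ ‖x - x'‖) :
        |a * u - a' * u'| ≤ 3 * D * ‖x - x'‖ * exp (-1 * |z|) := by
      rw [show a * u - a' * u' = a * (u - u') + (a - a') * u' by ring]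
      refine (abs_add_le _ _).trans ?_
      rw [abs_mul, abs_mul]
      calc |a| * |u - u'| + |a - a'| * |u'|
          ≤ (D * exp (-1 * |z|)) * ‖x - x'‖ + (D * ‖x - x'‖ * exp (-1 * |z|)) * 2 := by
            refine add_le_add (mul_le_mul ha hdu (abs_nonneg _) (by positivity))
              (mul_le_mul (hl.trans ?_) hu' (abs_nonneg _) (by positivity))
            gcongr
        _ = _ := by ring
    have r₁ := key _ _ _ _ D₁ (b₁ y z) (l₁ x'.1 (abs_fst_le hx') y z) hD₁ (hU' z) hdU
    have r₂ := key _ _ _ _ D₂ (b₂ y z) (l₂ x'.1 (abs_fst_le hx') y z) hD₂ (hV' z) hdV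
    rw [pairing, pairing, add_sub_add_comm]
    refine (abs_add_le _ _).trans ((add_le_add r₁ r₂).trans_eq ?_)
    ring

lemma exists_integral_operator {N₁ N₂ : ℝ → ℝ → ℝ → ℝ → ℝ}
    (h₁ : IsKernel (-1) N₁) (h₂ : IsKernel (-1) N₂) :
    ∃ C : ℝ, 0 ≤ C ∧ ∀ ω ∈ Ioo (0 : ℝ) 1, ∃ G : Triple → (ℝ →ᵇ ℝ),
      ∀ x : Triple, ‖x - base‖ ≤ 1 / 4 →
        (∀ y, G x y = ∫ z, pairing N₁ N₂ ω x y z) ∧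
        ‖G x‖ ≤ C ∧
        (x ∈ evenTriples → ∀ y, G x (-y) = G x y) ∧
        ∀ x' : Triple, ‖x' - base‖ ≤ 1 / 4 → ‖G x - G x'‖ ≤ C * ‖x - x'‖ := by
  obtain ⟨D, hD, h⟩ := exists_pairing_bound h₁ h₂
  set I : ℝ := ∫ z : ℝ, exp (-1 * |z|)
  have hI : 0 ≤ I := integral_nonneg fun z => (exp_pos _).le
  have hint := integrable_exp_neg_mul_abs one_pos
  refine ⟨D * I, by positivity, fun ω hω => ?_⟩
  have hG (x : Triple) (hx : ‖x - base‖ ≤ 1 / 4) :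
      ∃ g : ℝ →ᵇ ℝ, (∀ y, g y = ∫ z, pairing N₁ N₂ ω x y z) ∧ ‖g‖ ≤ D * I := by
    obtain ⟨c, -, b, -⟩ := h ω hω x hx
    have hb (y : ℝ) : ‖∫ z, pairing N₁ N₂ ω x y z‖ ≤ D * I := by
      rw [← integral_const_mul]
      exact norm_integral_le_of_norm_le (hint.const_mul D) (Eventually.of_forall (b y))
    have hc : Continuous fun y => ∫ z, pairing N₁ N₂ ω x y z :=
      continuous_of_dominated
        (fun y => (c.comp (Continuous.prodMk_right y)).aestronglyMeasurable)
        (fun y => Eventually.of_forall (b y)) (hint.const_mul D)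
        (Eventually.of_forall fun z => c.comp (Continuous.prodMk_left z))
    exact ⟨.ofNormedAddCommGroup _ hc _ hb, fun y => rfl,
      BoundedContinuousFunction.norm_ofNormedAddCommGroup_le _ (by positivity) hb⟩
  choose! G hG hGn using hG
  refine ⟨G, fun x hx => ⟨hG x hx, hGn x hx, fun hev y => ?_, fun x' hx' => ?_⟩⟩
  · rw [hG x hx, hG x hx, ← integral_neg_eq_self]
    simp only [(h ω hω x hx).2.1 hev]
  · refine (BoundedContinuousFunction.norm_le (by positivity)).2 fun y => ?_
    obtain ⟨c, -, b, l⟩ := h ω hω x hx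
    obtain ⟨c', -, b', -⟩ := h ω hω x' hx'
    have i : Integrable (pairing N₁ N₂ ω x y) :=
      integrable_of_abs_le_exp (c.comp (Continuous.prodMk_right y)) (b y)
    have i' : Integrable (pairing N₁ N₂ ω x' y) :=
      integrable_of_abs_le_exp (c'.comp (Continuous.prodMk_right y)) (b' y)
    rw [BoundedContinuousFunction.coe_sub, Pi.sub_apply, hG x hx, hG x' hx', ← integral_sub i i',
      show D * I * ‖x - x'‖ = D * ‖x - x'‖ * I by ring, ← integral_const_mul]
    exact norm_integral_le_of_norm_le (hint.const_mul _) (Eventually.of_forall (l x' hx' y))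

lemma exists_fixedPoint_of_small {X : Type*} [NormedAddCommGroup X] [NormedSpace ℝ X]
    [CompleteSpace X] {S : Set X} (hS : IsClosed S) {x₀ : X} (hx₀ : x₀ ∈ S) {F : X → X}
    {r M ω : ℝ} (hr : 0 ≤ r) (hω : 0 ≤ ω) (hωr : ω * M ≤ r) (hω2 : ω * M ≤ 1 / 2)
    (hF : ∀ x ∈ S, ‖x - x₀‖ ≤ r → ‖F x‖ ≤ M ∧ x₀ + ω • F x ∈ S ∧
      ∀ x' ∈ S, ‖x' - x₀‖ ≤ r → ‖F x - F x'‖ ≤ M * ‖x - x'‖) :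
    ∃ x ∈ S, ‖x - x₀‖ ≤ r ∧ x = x₀ + ω • F x := by
  set s : Set X := {x | x ∈ S ∧ ‖x - x₀‖ ≤ r}
  have hs : IsClosed s :=
    hS.inter (isClosed_le (continuous_id.sub continuous_const).norm continuous_const)
  have hmaps : MapsTo (fun x => x₀ + ω • F x) s s := fun x hx => by
    obtain ⟨h1, h2, -⟩ := hF x hx.1 hx.2
    refine ⟨h2, ?_⟩
    rw [add_sub_cancel_left, norm_smul, norm_eq_abs, abs_of_nonneg hω]
    exact (mul_le_mul_of_nonneg_left h1 hω).trans hωr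
  have hcontr : ContractingWith (1 / 2) (hmaps.restrict _ s s) := by
    refine ⟨by norm_num, LipschitzWith.of_dist_le_mul fun x x' => ?_⟩
    rw [Subtype.dist_eq, Subtype.dist_eq, dist_eq_norm, dist_eq_norm, MapsTo.val_restrict_apply,
      MapsTo.val_restrict_apply, add_sub_add_left_eq_sub, ← smul_sub, norm_smul, norm_eq_abs,
      abs_of_nonneg hω]
    have h := (hF x x.2.1 x.2.2).2.2 x' x'.2.1 x'.2.2
    calc ω * ‖F x - F x'‖ ≤ ω * (M * ‖(x : X) - x'‖) := mul_le_mul_of_nonneg_left h hω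
      _ = ω * M * ‖(x : X) - x'‖ := by ring
      _ ≤ 1 / 2 * ‖(x : X) - x'‖ := by gcongr
      _ = _ := by norm_num
  obtain ⟨x, hx, hfix, -⟩ := hcontr.exists_fixedPoint' hs.isComplete hmaps
    (x := x₀) ⟨hx₀, by simpa using hr⟩ (edist_ne_top _ _)
  exact ⟨x, hx.1, hx.2, hfix.symm⟩

/-- Weight converting the normalisation of the second component to that of the first. -/
noncomputable def tilt (α z : ℝ) : ℝ := exp ((1 * α + -1 / 2) * |z|)

/-- Kernel of the equation for `α`. -/
noncomputable def kerα (ω α _y z : ℝ) : ℝ :=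
  1 / 12 * (pot ω z + pot ω z * exp ((-2 * α + 0) * |z|))

/-- Kernel of the equation for `U`. -/
noncomputable def kerU (ω α y z : ℝ) : ℝ :=
  -1 / 6 * (volt α (max (|z| - |y|) 0) * pot ω z)

/-- Kernel of the equation for `V`, up to the weight of the component it acts on. -/
noncomputable def kerV (ω α y z : ℝ) : ℝ :=
  exp (1 / 2 * |y|) * (exp (-rate α * |y - z|) / (2 * rate α)) * pot ω z

lemma isKernel_tilt : IsKernel (3 / 4) (fun _ α _ z => tilt α z) :=
  (isKernel_exp 1 (-1 / 2)).mono (by norm_num)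

lemma isKernel_kerα : IsKernel (-2) kerα :=
  ((isKernel_pot.mono (by norm_num)).add
    ((isKernel_pot.mul (isKernel_exp (-2) 0)).mono (by norm_num))).const_mul _

lemma isKernel_kerU : IsKernel (-2) kerU :=
  ((isKernel_volt.mul isKernel_pot).const_mul _).mono (by norm_num)

lemma isKernel_kerV : IsKernel (-7 / 2) kerV :=
  (isKernel_green.mul isKernel_pot).mono (by norm_num)

/-- Action of the `α`-equation on a triple. -/
noncomputable def actα : ℝ → Triple → ℝ → ℝ → ℝ :=
  pairing kerα (fun ω α y z => -2 * (kerα ω α y z * tilt α z))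

/-- Action of the `U`-equation on a triple. -/
noncomputable def actU : ℝ → Triple → ℝ → ℝ → ℝ :=
  pairing kerU (fun ω α y z => -2 * (kerU ω α y z * tilt α z))

/-- Action of the `V`-equation on a triple. -/
noncomputable def actV : ℝ → Triple → ℝ → ℝ → ℝ :=
  pairing (fun ω α y z => -2 / 3 * (kerV ω α y z * exp ((-1 * α + 0) * |z|)))
    (fun ω α y z => 1 / 3 * (kerV ω α y z * exp ((0 * α + -1 / 2) * |z|)))

lemma exists_triple :
    ∃ M > (0 : ℝ), ∃ ω₀ ∈ Ioc (0 : ℝ) 1, ∀ ω ∈ Ioo (0 : ℝ) ω₀, ∃ x ∈ evenTriples,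
      ‖x - base‖ ≤ 1 / 4 ∧ ‖x - base‖ ≤ M * ω ∧
      |x.1 - ω * ∫ z, actα ω base 0 z| ≤ M * ω ^ 2 ∧
      x.1 = ω * ∫ z, actα ω x 0 z ∧
      (∀ y, x.2.1 y = 1 + ω * ∫ z, actU ω x y z) ∧
      (∀ y, x.2.2 y = ω * ∫ z, actV ω x y z) := by
  obtain ⟨Cα, hCα, hα⟩ := exists_integral_operator (isKernel_kerα.mono (by norm_num))
    (((isKernel_kerα.mul isKernel_tilt).const_mul (-2)).mono (by norm_num))
  obtain ⟨CU, hCU, hU⟩ := exists_integral_operator (isKernel_kerU.mono (by norm_num))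
    (((isKernel_kerU.mul isKernel_tilt).const_mul (-2)).mono (by norm_num))
  obtain ⟨CV, hCV, hV⟩ := exists_integral_operator
    (((isKernel_kerV.mul (isKernel_exp (-1) 0)).const_mul (-2 / 3)).mono (by norm_num))
    (((isKernel_kerV.mul (isKernel_exp 0 (-1 / 2))).const_mul (1 / 3)).mono (by norm_num))
  set C := Cα + CU + CV + 1 with hC
  have hCpos : 0 < C := by positivity
  refine ⟨C ^ 2 + C, by positivity, min 1 (1 / (4 * C)), ⟨by positivity, min_le_left _ _⟩,
    fun ω hω => ?_⟩
  have hω1 : ω ∈ Ioo (0 : ℝ) 1 := ⟨hω.1, hω.2.trans_le (min_le_left _ _)⟩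
  have hωC : ω * C ≤ 1 / 4 := by
    have := (hω.2.trans_le (min_le_right _ _)).le
    rw [le_div_iff₀ (by positivity)] at this
    linarith
  obtain ⟨Gα, hα⟩ := hα ω hω1
  obtain ⟨GU, hU⟩ := hU ω hω1
  obtain ⟨GV, hV⟩ := hV ω hω1
  have hbase : base ∈ evenTriples := fun y => ⟨rfl, rfl⟩
  have hnorm (t : ℝ) (f g : ℝ →ᵇ ℝ) : ‖((t, f, g) : Triple)‖ = max |t| (max ‖f‖ ‖g‖) := rfl
  have heval (f : ℝ →ᵇ ℝ) : |f 0| ≤ ‖f‖ := f.norm_coe_le_norm 0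
  obtain ⟨x, hxS, hx, hfix⟩ := exists_fixedPoint_of_small isClosed_evenTriples hbase
    (F := fun x => (Gα x 0, GU x, GV x)) (r := 1 / 4) (M := C) (ω := ω) (by norm_num) hω.1.le
    hωC (by linarith) (fun x hxS hx => by
      obtain ⟨-, bα, -, lα⟩ := hα x hx
      obtain ⟨-, bU, eU, lU⟩ := hU x hx
      obtain ⟨-, bV, eV, lV⟩ := hV x hx
      refine ⟨?_, fun y => ⟨?_, ?_⟩, fun x' _ hx' => ?_⟩
      · rw [hnorm]
        refine max_le ?_ (max_le ?_ ?_)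
        · linarith [heval (Gα x)]
        · linarith
        · linarith
      · change 1 + ω * GU x (-y) = 1 + ω * GU x y
        rw [eU hxS]
      · change 0 + ω * GV x (-y) = 0 + ω * GV x y
        rw [eV hxS]
      · change ‖((Gα x 0 - Gα x' 0, GU x - GU x', GV x - GV x') : Triple)‖ ≤ _
        have hn := norm_nonneg (x - x')
        have hle (D : ℝ) (hD : D ≤ C) (t : ℝ) (ht : t ≤ D * ‖x - x'‖) : t ≤ C * ‖x - x'‖ :=
          ht.trans (mul_le_mul_of_nonneg_right hD hn)
        rw [hnorm]
        refine max_le ?_ (max_le ?_ ?_)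
        · exact hle Cα (by linarith) _ ((heval (Gα x - Gα x')).trans (lα x' hx'))
        · exact hle CU (by linarith) _ (lU x' hx')
        · exact hle CV (by linarith) _ (lV x' hx'))
  have hfixα : x.1 = 0 + ω * Gα x 0 := congrArg Prod.fst hfix
  have hfixU : x.2.1 = 1 + ω • GU x := congrArg (fun x => x.2.1) hfix
  have hfixV : x.2.2 = 0 + ω • GV x := congrArg (fun x => x.2.2) hfix
  obtain ⟨iα, bα, -, lα⟩ := hα x hx
  obtain ⟨iU, bU, -, -⟩ := hU x hx
  obtain ⟨iV, bV, -, -⟩ := hV x hx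
  have hb : ‖base - base‖ ≤ 1 / 4 := by simp
  have hxω : ‖x - base‖ ≤ C * ω := by
    have h : x - base = ω • ((Gα x 0, GU x, GV x) : Triple) := by
      nth_rewrite 1 [hfix]
      exact add_sub_cancel_left _ _
    rw [h, norm_smul, norm_eq_abs, abs_of_pos hω.1, hnorm, mul_comm]
    refine mul_le_mul_of_nonneg_right (max_le ?_ (max_le ?_ ?_)) hω.1.le
    · linarith [heval (Gα x)]
    · linarith
    · linarith
  refine ⟨x, hxS, hx, hxω.trans ?_, ?_, ?_, fun y => ?_, fun y => ?_⟩
  · nlinarith [hω.1, sq_nonneg C]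
  · have h1 : |Gα x 0 - Gα base 0| ≤ C * (C * ω) :=
      ((heval (Gα x - Gα base)).trans (lα base hb)).trans
        (mul_le_mul (by linarith) hxω (norm_nonneg _) hCpos.le)
    rw [actα, ← (hα base hb).1 0, hfixα, zero_add, ← mul_sub, abs_mul, abs_of_pos hω.1]
    calc ω * |Gα x 0 - Gα base 0| ≤ ω * (C * (C * ω)) := mul_le_mul_of_nonneg_left h1 hω.1.le
      _ = C ^ 2 * ω ^ 2 := by ring
      _ ≤ (C ^ 2 + C) * ω ^ 2 := by gcongr; linarith
  · rw [actα, ← iα 0]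
    linarith
  · rw [actU, ← iU y]
    exact DFunLike.congr_fun hfixU y
  · rw [actV, ← iV y]
    have := DFunLike.congr_fun hfixV y
    simpa using this

lemma hasDerivAt_integral_Iic {f : ℝ → ℝ} (hf : Continuous f)
    (hint : ∀ y, IntegrableOn f (Iic y)) (y : ℝ) :
    HasDerivAt (fun y => ∫ z in Iic y, f z) (f y) y := by
  have h : (fun y => ∫ z in Iic y, f z) = fun y => (∫ z in Iic 0, f z) + ∫ z in (0 : ℝ)..y, f z := by
    funext t
    rw [← intervalIntegral.integral_Iic_sub_Iic (hint 0) (hint t)]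
    ring
  rw [h]
  exact (hf.integral_hasStrictDerivAt 0 y).hasDerivAt.const_add _

lemma hasDerivAt_integral_Ioi {f : ℝ → ℝ} (hf : Continuous f)
    (hint : ∀ y, IntegrableOn f (Ioi y)) (y : ℝ) :
    HasDerivAt (fun y => ∫ z in Ioi y, f z) (-f y) y := by
  have h : (fun y => ∫ z in Ioi y, f z) = fun y => (∫ z in Ioi 0, f z) - ∫ z in (0 : ℝ)..y, f z := by
    funext t
    rw [← intervalIntegral.integral_interval_add_Ioi (hint 0) (hint t)]
    ring
  rw [h]
  exact (hf.integral_hasStrictDerivAt 0 y).hasDerivAt.const_sub _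

/-- Convolution with `e^{-κ|y|} / (2κ)` inverts `-∂² + κ²`. -/
lemma exists_hasDerivAt_green {κ : ℝ} (hκ : 0 < κ) {h w : ℝ → ℝ} (hh : Continuous h)
    (hi : Integrable h) (hw : ∀ y, w y = ∫ z, exp (-κ * |y - z|) / (2 * κ) * h z) :
    ∃ w' : ℝ → ℝ, ∀ y, HasDerivAt w (w' y) y ∧ HasDerivAt w' (κ ^ 2 * w y - h y) y := by
  have hc₁ : Continuous fun z => exp (κ * z) * h z := by fun_prop
  have hc₂ : Continuous fun z => exp (-κ * z) * h z := by fun_prop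
  have i₁ (y : ℝ) : IntegrableOn (fun z => exp (κ * z) * h z) (Iic y) := by
    refine ((hi.norm.const_mul (exp (κ * y))).integrableOn).mono' hc₁.aestronglyMeasurable ?_
    refine (ae_restrict_iff' measurableSet_Iic).2 (Eventually.of_forall fun z hz => ?_)
    rw [norm_mul, norm_eq_abs (exp _), abs_of_pos (exp_pos _)]
    gcongr
    exact hz
  have i₂ (y : ℝ) : IntegrableOn (fun z => exp (-κ * z) * h z) (Ioi y) := by
    refine ((hi.norm.const_mul (exp (-κ * y))).integrableOn).mono' hc₂.aestronglyMeasurable ?_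
    refine (ae_restrict_iff' measurableSet_Ioi).2 (Eventually.of_forall fun z hz => ?_)
    rw [norm_mul, norm_eq_abs (exp _), abs_of_pos (exp_pos _)]
    refine mul_le_mul_of_nonneg_right (exp_le_exp.2 ?_) (norm_nonneg _)
    nlinarith [mem_Ioi.1 hz]
  obtain ⟨P, hP⟩ : ∃ P : ℝ → ℝ, P = fun y => ∫ z in Iic y, exp (κ * z) * h z := ⟨_, rfl⟩
  obtain ⟨R, hR⟩ : ∃ R : ℝ → ℝ, R = fun y => ∫ z in Ioi y, exp (-κ * z) * h z := ⟨_, rfl⟩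
  have dP (y : ℝ) : HasDerivAt P (exp (κ * y) * h y) y := by
    rw [hP]
    exact hasDerivAt_integral_Iic hc₁ i₁ y
  have dR (y : ℝ) : HasDerivAt R (-(exp (-κ * y) * h y)) y := by
    rw [hR]
    exact hasDerivAt_integral_Ioi hc₂ i₂ y
  have e₁ (y z : ℝ) (hz : z ∈ Iic y) : exp (-κ * |y - z|) / (2 * κ) * h z
      = exp (-κ * y) / (2 * κ) * (exp (κ * z) * h z) := by
    rw [abs_of_nonneg (sub_nonneg.2 hz), show -κ * (y - z) = -κ * y + κ * z by ring, exp_add]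
    ring
  have e₂ (y z : ℝ) (hz : z ∈ Ioi y) : exp (-κ * |y - z|) / (2 * κ) * h z
      = exp (κ * y) / (2 * κ) * (exp (-κ * z) * h z) := by
    rw [abs_of_neg (sub_neg.2 hz), show -κ * -(y - z) = κ * y + -κ * z by ring, exp_add]
    ring
  have hwPR : w = fun y => exp (-κ * y) / (2 * κ) * P y + exp (κ * y) / (2 * κ) * R y := by
    funext y
    rw [hw, ← intervalIntegral.integral_Iic_add_Ioi (b := y)
      (IntegrableOn.congr_fun ((i₁ y).const_mul (exp (-κ * y) / (2 * κ)))
        (fun z hz => (e₁ y z hz).symm) measurableSet_Iic)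
      (IntegrableOn.congr_fun ((i₂ y).const_mul (exp (κ * y) / (2 * κ)))
        (fun z hz => (e₂ y z hz).symm) measurableSet_Ioi),
      setIntegral_congr_fun measurableSet_Iic (e₁ y), setIntegral_congr_fun measurableSet_Ioi (e₂ y),
      integral_const_mul, integral_const_mul, hP, hR]
  have dE (c y : ℝ) : HasDerivAt (fun y => exp (c * y)) (c * exp (c * y)) y := by
    simpa [mul_comm] using ((hasDerivAt_id y).const_mul c).exp
  have hE (y : ℝ) : exp (-(κ * y)) * exp (κ * y) = 1 := by rw [← exp_add]; simp
  refine ⟨fun y => -1 / 2 * exp (-κ * y) * P y + exp (κ * y) / 2 * R y, fun y => ⟨?_, ?_⟩⟩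
  · rw [hwPR]
    refine ((((dE (-κ) y).div_const (2 * κ)).mul (dP y)).add
      (((dE κ y).div_const (2 * κ)).mul (dR y))).congr_deriv ?_
    field_simp
    ring
  · refine ((((dE (-κ) y).const_mul (-1 / 2)).mul (dP y)).add
      (((dE κ y).div_const 2).mul (dR y))).congr_deriv ?_
    simp only [hwPR]
    field_simp
    linear_combination -2 * h y * hE y

lemma contDiff_succ_of_hasDerivAt {n : ℕ} {w w' F : ℝ → ℝ} (h₁ : ∀ y, HasDerivAt w (w' y) y)
    (h₂ : ∀ y, HasDerivAt w' (F y) y) (hF : ContDiff ℝ n F) : ContDiff ℝ (n + 1) w := by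
  have e₁ : deriv w = w' := funext fun y => (h₁ y).deriv
  have e₂ : deriv w' = F := funext fun y => (h₂ y).deriv
  have hw' : ContDiff ℝ (n + 1) w' :=
    contDiff_succ_iff_deriv.2 ⟨fun y => (h₂ y).differentiableAt, by simp, by rwa [e₂]⟩
  refine contDiff_succ_iff_deriv.2 ⟨fun y => (h₁ y).differentiableAt, by simp, ?_⟩
  rw [e₁]
  exact hw'.of_le (by exact_mod_cast Nat.le_succ n)

lemma integrable_pot {ω : ℝ} (hω : 0 ≤ ω) : Integrable (pot ω) := by
  refine integrable_of_abs_le_exp (continuous_pot hω) (C := 64) fun z => ?_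
  rw [abs_of_nonneg (pot_nonneg ω z)]
  refine (pot_le hω z).trans ?_
  gcongr
  norm_num

lemma aCoef_zero : aCoef 0 = 1 := by simp [aCoef]

lemma integral_pot_zero : ∫ z, pot 0 z = 16 / 3 := by
  have hderiv (y : ℝ) : HasDerivAt
      (fun y => -16 / (exp (2 * y) + 1) ^ 2 + 32 / (3 * (exp (2 * y) + 1) ^ 3)) (pot 0 y) y := by
    have dE : HasDerivAt (fun y => exp (2 * y) + 1) (2 * exp (2 * y)) y := by
      simpa [mul_comm] using (((hasDerivAt_id y).const_mul 2).exp).add_const 1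
    have hpos : 0 < exp (2 * y) + 1 := by positivity
    refine (((hasDerivAt_const y (-16 : ℝ)).div (dE.pow 2) (pow_ne_zero _ hpos.ne')).add
      ((hasDerivAt_const y (32 : ℝ)).div ((dE.pow 3).const_mul 3)
        (mul_ne_zero three_ne_zero (pow_ne_zero _ hpos.ne')))).congr_deriv ?_
    simp only [Pi.pow_apply]
    rw [pot, aCoef_zero, cosh_eq, exp_neg]
    have h2 : 1 + 1 * ((exp (2 * y) + (exp (2 * y))⁻¹) / 2)
        = (exp (2 * y) + 1) ^ 2 / (2 * exp (2 * y)) := by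
      field_simp
      ring
    rw [h2]
    field_simp
    ring
  have hlim (t : ℝ) (ht : t + 1 ≠ 0) : Tendsto (fun t : ℝ =>
      -16 / (t + 1) ^ 2 + 32 / (3 * (t + 1) ^ 3)) (𝓝 t)
      (𝓝 (-16 / (t + 1) ^ 2 + 32 / (3 * (t + 1) ^ 3))) := by
    have h2 : (t + 1) ^ 2 ≠ 0 := pow_ne_zero _ ht
    have h3 : 3 * (t + 1) ^ 3 ≠ 0 := mul_ne_zero three_ne_zero (pow_ne_zero _ ht)
    exact ContinuousAt.tendsto (x := t) (by fun_prop (disch := assumption))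
  have hbot : Tendsto (fun y : ℝ => exp (2 * y)) atBot (𝓝 0) :=
    tendsto_exp_atBot.comp (tendsto_id.const_mul_atBot two_pos)
  have htop : Tendsto (fun y : ℝ => exp (2 * y) + 1) atTop atTop :=
    tendsto_atTop_add_const_right _ _
      (tendsto_exp_atTop.comp (tendsto_id.const_mul_atTop two_pos))
  have h := integral_of_hasDerivAt_of_tendsto hderiv (integrable_pot le_rfl)
    ((hlim 0 (by norm_num)).comp hbot)
    ((((tendsto_pow_atTop two_ne_zero).comp htop).const_div_atTop (-16)).add
      ((((tendsto_pow_atTop three_ne_zero).comp htop).const_mul_atTop three_pos).const_div_atTop 32))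
  rw [h]
  norm_num

lemma abs_pot_sub_pot_zero_le {ω : ℝ} (hω : 0 ≤ ω) (y : ℝ) :
    |pot ω y - pot 0 y| ≤ 16 * ω / 3 * pot 0 y := by
  have ha := one_le_aCoef hω
  have ha2 : aCoef ω ^ 2 = 1 + 16 * ω / 3 := by rw [aCoef, sq_sqrt (by positivity)]
  have hc := cosh_pos (2 * y)
  have hle : pot ω y ≤ pot 0 y := by
    rw [pot, pot, aCoef_zero]
    gcongr
  have hge : pot 0 y ≤ aCoef ω ^ 2 * pot ω y := by
    rw [pot, pot, aCoef_zero, one_mul, mul_div_assoc', div_le_div_iff₀ (by positivity)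
      (by positivity)]
    have : (1 + aCoef ω * cosh (2 * y)) ^ 2 ≤ (aCoef ω * (1 + cosh (2 * y))) ^ 2 := by
      gcongr
      linarith
    linarith
  have h0 := pot_nonneg ω y
  rw [abs_of_nonpos (by linarith)]
  rw [ha2] at hge
  nlinarith

lemma integral_actα_base {ω : ℝ} (hω : 0 ≤ ω) :
    |(∫ z, actα ω base 0 z) - 8 / 9| ≤ 5 * ω := by
  have h : ∀ z, actα ω base 0 z = 1 / 6 * pot ω z := fun z => by
    simp [actα, pairing, kerα, base]
    ring
  simp only [h]
  rw [integral_const_mul]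
  have hd : |(∫ z, pot ω z) - 16 / 3| ≤ 16 * ω / 3 * (16 / 3) := by
    rw [← integral_pot_zero, ← integral_sub (integrable_pot hω) (integrable_pot le_rfl),
      ← integral_const_mul]
    exact norm_integral_le_of_norm_le (f := fun z => pot ω z - pot 0 z)
      (g := fun z => 16 * ω / 3 * pot 0 z)
      ((integrable_pot le_rfl).const_mul _)
      (Eventually.of_forall fun z => abs_pot_sub_pot_zero_le hω z)
  rw [abs_le] at hd ⊢
  constructor <;> linarith

lemma exp_abs_sub_add_exp_abs_add (α y z : ℝ) :
    exp (-α * |y - z|) + exp (-α * |y + z|)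
      = exp (-α * |(|y| - |z|)|) + exp (-α * (|y| + |z|)) := by
  rcases le_total 0 y with hy | hy <;> rcases le_total 0 z with hz | hz
  · rw [abs_of_nonneg hy, abs_of_nonneg hz, abs_of_nonneg (add_nonneg hy hz)]
  · rw [abs_of_nonneg hy, abs_of_nonpos hz, abs_of_nonneg (by linarith : 0 ≤ y - z),
      sub_neg_eq_add, ← sub_eq_add_neg, add_comm]
  · rw [abs_of_nonpos hy, abs_of_nonneg hz, abs_of_nonpos (by linarith : y - z ≤ 0),
      show -y - z = -(y + z) by ring, abs_neg, show -(y - z) = -y + z by ring, add_comm]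
  · rw [abs_of_nonpos hy, abs_of_nonpos hz, abs_of_nonpos (by linarith : y + z ≤ 0),
      show -y - -z = -(y - z) by ring, abs_neg, show -(y + z) = -y + -z by ring]

lemma green_even_part {α : ℝ} (hα : 0 < α) (y z : ℝ) :
    (exp (-α * |y - z|) / (2 * α) + exp (-α * |y + z|) / (2 * α)) / 2 =
      exp (-α * |y|) * (exp (α * |z|) *
        ((1 + exp ((-2 * α + 0) * |z|)) / (4 * α) - volt α (max (|z| - |y|) 0) / 2)) := by
  rw [← add_div, exp_abs_sub_add_exp_abs_add, volt_eq hα.ne']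
  have hz2 : exp ((-2 * α + 0) * |z|) = (exp (α * |z|))⁻¹ ^ 2 := by
    rw [← exp_neg, ← exp_nat_mul]; congr 1; push_cast; ring
  have hny (s : ℝ) : exp (-α * s) = (exp (α * s))⁻¹ := by rw [← exp_neg]; congr 1; ring
  rw [hz2, hny, hny, hny, mul_add, exp_add]
  rcases le_total |z| |y| with h | h
  · rw [max_eq_right (by linarith), abs_of_nonneg (by linarith), mul_sub, exp_sub]
    simp
    field_simp
    ring
  · have hs : exp (-2 * α * (|z| - |y|)) = (exp (α * |z|))⁻¹ ^ 2 * exp (α * |y|) ^ 2 := by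
      rw [← exp_neg, ← exp_nat_mul, ← exp_nat_mul, ← exp_add]; congr 1; push_cast; ring
    rw [max_eq_left (by linarith), abs_of_nonpos (by linarith), neg_sub, mul_sub, exp_sub, hs]
    field_simp
    ring

lemma integrable_pairing {N₁ N₂ : ℝ → ℝ → ℝ → ℝ → ℝ} (h₁ : IsKernel (-1) N₁)
    (h₂ : IsKernel (-1) N₂) {ω : ℝ} (hω : ω ∈ Ioo (0 : ℝ) 1) {x : Triple}
    (hx : ‖x - base‖ ≤ 1 / 4) (y : ℝ) : Integrable (pairing N₁ N₂ ω x y) := by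
  obtain ⟨D, -, h⟩ := exists_pairing_bound h₁ h₂
  obtain ⟨c, -, b, -⟩ := h ω hω x hx
  exact integrable_of_abs_le_exp (c.comp (Continuous.prodMk_right y)) (b y)

/-- The component of the solution decaying like `e^{-α|y|}`. -/
noncomputable def slow (x : Triple) (y : ℝ) : ℝ := exp (-x.1 * |y|) * x.2.1 y

/-- The component of the solution decaying at a rate bounded away from zero. -/
noncomputable def fast (x : Triple) (y : ℝ) : ℝ := exp (-1 / 2 * |y|) * x.2.2 y

lemma continuous_slow (x : Triple) : Continuous (slow x) := by
  have := x.2.1.continuous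
  unfold slow
  fun_prop

lemma continuous_fast (x : Triple) : Continuous (fast x) := by
  have := x.2.2.continuous
  unfold fast
  fun_prop

lemma abs_slow_le {x : Triple} (hx : ‖x - base‖ ≤ 1 / 4) (hα : 0 < x.1) (y : ℝ) :
    |slow x y| ≤ 2 := by
  have h : exp (-x.1 * |y|) ≤ 1 := exp_le_one_iff.2 (by nlinarith [abs_nonneg y])
  rw [slow, abs_mul, abs_of_pos (exp_pos _)]
  nlinarith [abs_snd_fst_le hx y, abs_nonneg (x.2.1 y), exp_pos (-x.1 * |y|)]

lemma abs_fast_le {x : Triple} (hx : ‖x - base‖ ≤ 1 / 4) (y : ℝ) : |fast x y| ≤ 2 := by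
  have h : exp (-1 / 2 * |y|) ≤ 1 := exp_le_one_iff.2 (by nlinarith [abs_nonneg y])
  rw [fast, abs_mul, abs_of_pos (exp_pos _)]
  nlinarith [abs_snd_snd_le hx y, abs_nonneg (x.2.2 y), exp_pos (-1 / 2 * |y|)]

/-- The potential multiplied by a combination of the two components. -/
noncomputable def source (c d ω : ℝ) (x : Triple) (z : ℝ) : ℝ :=
  ω / 3 * pot ω z * (c * slow x z + d * fast x z)

lemma continuous_source {ω : ℝ} (hω : 0 ≤ ω) (c d : ℝ) (x : Triple) :
    Continuous (source c d ω x) := by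
  have h₁ := continuous_pot hω
  have h₂ := continuous_slow x
  have h₃ := continuous_fast x
  unfold source
  fun_prop

lemma integrable_source {ω : ℝ} (hω : 0 ≤ ω) (c d : ℝ) {x : Triple} (hx : ‖x - base‖ ≤ 1 / 4)
    (hα : 0 < x.1) : Integrable (source c d ω x) := by
  refine ((integrable_pot hω).const_mul (ω / 3 * (2 * |c| + 2 * |d|))).mono'
    (continuous_source hω c d x).aestronglyMeasurable (Eventually.of_forall fun z => ?_)
  rw [source, norm_eq_abs, abs_mul, abs_of_nonneg (mul_nonneg (by positivity) (pot_nonneg ω z)),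
    show ω / 3 * (2 * |c| + 2 * |d|) * pot ω z
      = ω / 3 * pot ω z * (|c| * 2 + |d| * 2) by ring]
  refine mul_le_mul_of_nonneg_left ?_ (mul_nonneg (by positivity) (pot_nonneg ω z))
  refine (abs_add_le _ _).trans ?_
  rw [abs_mul, abs_mul]
  gcongr
  exacts [abs_slow_le hx hα z, abs_fast_le hx z]

lemma slow_eq_integral {ω : ℝ} (hω : ω ∈ Ioo (0 : ℝ) 1) {x : Triple} (hev : x ∈ evenTriples)
    (hx : ‖x - base‖ ≤ 1 / 4) (hα : 0 < x.1) (hfα : x.1 = ω * ∫ z, actα ω x 0 z)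
    (hfU : ∀ y, x.2.1 y = 1 + ω * ∫ z, actU ω x y z) (y : ℝ) :
    slow x y = ∫ z, exp (-x.1 * |y - z|) / (2 * x.1) * source 1 (-2) ω x z := by
  have hi := integrable_source hω.1.le 1 (-2) hx hα
  have hcs := continuous_source hω.1.le 1 (-2) x
  have hG (σ : ℝ) : Integrable fun z => exp (-x.1 * |y + σ * z|) / (2 * x.1)
      * source 1 (-2) ω x z := by
    refine hi.bdd_mul (c := 1 / (2 * x.1)) (by fun_prop) (Eventually.of_forall fun z => ?_)
    rw [norm_eq_abs, abs_of_pos (by positivity)]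
    gcongr
    exact exp_le_one_iff.2 (by nlinarith [abs_nonneg (y + σ * z)])
  have hG₁ := hG (-1)
  have hG₂ := hG 1
  simp only [neg_one_mul, one_mul, ← sub_eq_add_neg] at hG₁ hG₂
  have hsrc (z : ℝ) : source 1 (-2) ω x (-z) = source 1 (-2) ω x z := by
    simp only [source, slow, fast, pot_neg, abs_neg, (hev z).1, (hev z).2]
  have hflip : ∫ z, exp (-x.1 * |y - z|) / (2 * x.1) * source 1 (-2) ω x z
      = ∫ z, exp (-x.1 * |y + z|) / (2 * x.1) * source 1 (-2) ω x z := by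
    rw [← integral_neg_eq_self]
    simp only [hsrc, sub_neg_eq_add]
  have hpt (z : ℝ) : (exp (-x.1 * |y - z|) / (2 * x.1) * source 1 (-2) ω x z
      + exp (-x.1 * |y + z|) / (2 * x.1) * source 1 (-2) ω x z) / 2
      = exp (-x.1 * |y|) * (ω / x.1 * actα ω x 0 z + ω * actU ω x y z) := by
    have hE : exp (x.1 * |z|) * exp (-x.1 * |z|) = 1 := by rw [← exp_add]; simp
    have hT : exp (x.1 * |z|) * exp (-1 / 2 * |z|) = tilt x.1 z := by
      rw [tilt, ← exp_add]
      congr 1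
      ring
    have hS : exp (x.1 * |z|) * source 1 (-2) ω x z
        = ω / 3 * pot ω z * (x.2.1 z - 2 * (tilt x.1 z * x.2.2 z)) := by
      rw [← hT, source, slow, fast]
      linear_combination ω / 3 * pot ω z * x.2.1 z * hE
    rw [← add_mul, mul_div_right_comm, green_even_part hα]
    simp only [actα, actU, pairing, kerα, kerU]
    linear_combination (norm := skip) exp (-x.1 * |y|) *
      ((1 + exp ((-2 * x.1 + 0) * |z|)) / (4 * x.1) - volt x.1 (max (|z| - |y|) 0) / 2) * hS
    field_simp
    ring
  have iα : Integrable (actα ω x 0) := integrable_pairing (isKernel_kerα.mono (by norm_num))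
    (((isKernel_kerα.mul isKernel_tilt).const_mul (-2)).mono (by norm_num)) hω hx 0
  have iU : Integrable (actU ω x y) := integrable_pairing (isKernel_kerU.mono (by norm_num))
    (((isKernel_kerU.mul isKernel_tilt).const_mul (-2)).mono (by norm_num)) hω hx y
  have hsum := integral_congr_ae (μ := volume) (Eventually.of_forall hpt)
  rw [integral_div, integral_add hG₁ hG₂, ← hflip, add_self_div_two, integral_const_mul,
    integral_add (iα.const_mul _) (iU.const_mul _), integral_const_mul, integral_const_mul] at hsum
  rw [hsum, slow, hfU, div_mul_eq_mul_div, ← hfα, div_self hα.ne']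

lemma fast_eq_integral {ω : ℝ} {x : Triple} (hfV : ∀ y, x.2.2 y = ω * ∫ z, actV ω x y z) (y : ℝ) :
    fast x y = ∫ z, exp (-rate x.1 * |y - z|) / (2 * rate x.1) * source (-2) 1 ω x z := by
  rw [fast, hfV, ← integral_const_mul, ← integral_const_mul]
  congr 1 with z
  have hE : exp (-1 / 2 * |y|) * exp (1 / 2 * |y|) = 1 := by
    rw [← exp_add, ← add_mul]
    norm_num
  simp only [actV, pairing, kerV, source, slow, fast]
  rw [show (-1 * x.1 + 0) * |z| = -x.1 * |z| by ring,
    show (0 * x.1 + -1 / 2) * |z| = -1 / 2 * |z| by ring]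
  linear_combination ω / 3 * (exp (-rate x.1 * |y - z|) / (2 * rate x.1)) * pot ω z *
    (-2 * (exp (-x.1 * |z|) * x.2.1 z) + exp (-1 / 2 * |z|) * x.2.2 z) * hE

lemma contDiff_of_coupled_system {ω a b : ℝ} (hω : 0 ≤ ω) {x : Triple} {u' v' : ℝ → ℝ}
    (hu : ∀ y, HasDerivAt (slow x) (u' y) y ∧
      HasDerivAt u' (a * slow x y - source 1 (-2) ω x y) y)
    (hv : ∀ y, HasDerivAt (fast x) (v' y) y ∧
      HasDerivAt v' (b * fast x y - source (-2) 1 ω x y) y) (n : ℕ) :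
    ContDiff ℝ n (slow x) ∧ ContDiff ℝ n (fast x) := by
  induction n with
  | zero =>
    simp only [Nat.cast_zero, contDiff_zero]
    exact ⟨continuous_slow x, continuous_fast x⟩
  | succ n ih =>
    obtain ⟨h₁, h₂⟩ := ih
    have h₃ : ContDiff ℝ n (pot ω) := contDiff_pot hω
    have hs (c d : ℝ) : ContDiff ℝ n (source c d ω x) := by
      unfold source
      fun_prop
    rw [Nat.cast_add, Nat.cast_one]
    exact ⟨contDiff_succ_of_hasDerivAt (fun y => (hu y).1) (fun y => (hu y).2)
        ((contDiff_const.mul h₁).sub (hs _ _)),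
      contDiff_succ_of_hasDerivAt (fun y => (hv y).1) (fun y => (hv y).2)
        ((contDiff_const.mul h₂).sub (hs _ _))⟩

lemma abs_slow_sub_add_abs_fast_le {x : Triple} {r : ℝ} (hx : ‖x - base‖ ≤ 1 / 4)
    (hr : ‖x - base‖ ≤ r) (y : ℝ) :
    |slow x y - exp (-x.1 * |y|)| + |fast x y| ≤ 2 * r * exp (-x.1 * |y|) := by
  have hU := ((x.2.1 - 1).norm_coe_le_norm y).trans (norm_snd_fst_sub_one_le hr)
  have hV := (x.2.2.norm_coe_le_norm y).trans (norm_snd_snd_le hr)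
  simp only [BoundedContinuousFunction.coe_sub, Pi.sub_apply, BoundedContinuousFunction.coe_one,
    Pi.one_apply, norm_eq_abs] at hU hV
  have hexp : exp (-1 / 2 * |y|) ≤ exp (-x.1 * |y|) := by
    have := (abs_le.1 (abs_fst_le hx)).2
    gcongr
    linarith
  rw [slow, fast, ← mul_sub_one, abs_mul, abs_mul, abs_of_pos (exp_pos _), abs_of_pos (exp_pos _)]
  calc exp (-x.1 * |y|) * |x.2.1 y - 1| + exp (-1 / 2 * |y|) * |x.2.2 y|
      ≤ exp (-x.1 * |y|) * r + exp (-x.1 * |y|) * r := by gcongr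
    _ = _ := by ring

end InternalMode

/-- Existence of the eigenvalue `λ = 1 - α²` and eigenfunctions `(W₁, W₂)` of the
transformed problem `M₊ W₁ = λ W₂`, `M₋ W₂ = λ W₁`, with `α = 8ω/9 + O(ω²)` and
`W_j(y) = e^{-α|y|}(1 + O(ω))`. -/
theorem transformed_internal_mode :
    ∃ C > (0 : ℝ), ∃ ω₁ > (0 : ℝ), ∀ ω ∈ Set.Ioo (0 : ℝ) ω₁,
      ∃ α ∈ Set.Ioo (0 : ℝ) 1, |α - 8 * ω / 9| ≤ C * ω ^ 2 ∧
        ∃ W₁ W₂ : ℝ → ℝ,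
          ContDiff ℝ (⊤ : ℕ∞) W₁ ∧ ContDiff ℝ (⊤ : ℕ∞) W₂ ∧
          (∀ y : ℝ, W₁ (-y) = W₁ y) ∧ (∀ y : ℝ, W₂ (-y) = W₂ y) ∧
          (∀ y : ℝ, Mp ω W₁ y = (1 - α ^ 2) * W₂ y) ∧
          (∀ y : ℝ, Mm ω W₂ y = (1 - α ^ 2) * W₁ y) ∧
          (∀ y : ℝ, |W₁ y - Real.exp (-α * |y|)| ≤ C * ω * Real.exp (-α * |y|)) ∧
          (∀ y : ℝ, |W₂ y - Real.exp (-α * |y|)| ≤ C * ω * Real.exp (-α * |y|)) := by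
  open InternalMode in
  obtain ⟨M, hM, ω₀, hω₀, h⟩ := exists_triple
  refine ⟨2 * M + 5, by positivity, min ω₀ (1 / (2 * (M + 5))),
    lt_min hω₀.1 (by positivity), fun ω hω => ?_⟩
  have hω1 : ω ∈ Set.Ioo (0 : ℝ) 1 := ⟨hω.1, (hω.2.trans_le (min_le_left _ _)).trans_le hω₀.2⟩
  have hωM : ω * (M + 5) ≤ 1 / 2 := by
    have := (hω.2.trans_le (min_le_right _ _)).le
    rw [le_div_iff₀ (by positivity)] at this
    linarith
  obtain ⟨x, hev, hx, hxω, hα8, hfα, hfU, hfV⟩ := h ω ⟨hω.1, hω.2.trans_le (min_le_left _ _)⟩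
  have hω0 := hω.1
  have hdist : |x.1 - 8 * ω / 9| ≤ (M + 5) * ω ^ 2 := by
    have h1 := mul_le_mul_of_nonneg_left (integral_actα_base hω0.le) hω0.le
    rw [← abs_of_pos hω0, ← abs_mul, abs_of_pos hω0] at h1
    rw [abs_le] at h1 hα8 ⊢
    constructor <;> linarith
  have hα : 0 < x.1 := by
    have := (abs_le.1 hdist).1
    nlinarith
  have hα4 : |x.1| ≤ 1 / 4 := abs_fst_le hx
  obtain ⟨u', hu⟩ := exists_hasDerivAt_green hα (continuous_source hω0.le 1 (-2) x)
    (integrable_source hω0.le 1 (-2) hx hα) (slow_eq_integral hω1 hev hx hα hfα hfU)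
  obtain ⟨v', hv⟩ := exists_hasDerivAt_green (one_pos.trans_le (one_le_rate hα4))
    (continuous_source hω0.le (-2) 1 x) (integrable_source hω0.le (-2) 1 hx hα)
    (fast_eq_integral hfV)
  have hsmooth (n : ℕ) := contDiff_of_coupled_system hω0.le hu hv n
  have hcu : ContDiff ℝ (⊤ : ℕ∞) (slow x) := contDiff_infty.2 fun n => (hsmooth n).1
  have hcv : ContDiff ℝ (⊤ : ℕ∞) (fast x) := contDiff_infty.2 fun n => (hsmooth n).2
  have hd₁ : deriv (fun y => slow x y + fast x y) = fun y => u' y + v' y :=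
    funext fun y => ((hu y).1.add (hv y).1).deriv
  have hd₂ : deriv (fun y => slow x y - fast x y) = fun y => u' y - v' y :=
    funext fun y => ((hu y).1.sub (hv y).1).deriv
  have hdd₁ (y : ℝ) := ((hu y).2.add (hv y).2).deriv
  have hdd₂ (y : ℝ) := ((hu y).2.sub (hv y).2).deriv
  have hbound (y : ℝ) : |slow x y - exp (-x.1 * |y|)| + |fast x y|
      ≤ (2 * M + 5) * ω * exp (-x.1 * |y|) := by
    refine (abs_slow_sub_add_abs_fast_le hx hxω y).trans ?_
    exact mul_le_mul_of_nonneg_right (by linarith) (exp_pos _).le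
  refine ⟨x.1, ⟨hα, (le_abs_self _).trans_lt (hα4.trans_lt (by norm_num))⟩,
    hdist.trans (by gcongr; linarith), fun y => slow x y + fast x y,
    fun y => slow x y - fast x y, hcu.add hcv, hcu.sub hcv, fun y => ?_, fun y => ?_,
    fun y => ?_, fun y => ?_, fun y => ?_, fun y => ?_⟩
  · simp only [slow, fast, abs_neg, (hev y).1, (hev y).2]
  · simp only [slow, fast, abs_neg, (hev y).1, (hev y).2]
  · have h2 : deriv (fun y => u' y + v' y) y = _ := hdd₁ y
    rw [Mp, hd₁, h2, Q_pow_four hω0.le, rate_sq hα4, source, source]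
    ring
  · have h2 : deriv (fun y => u' y - v' y) y = _ := hdd₂ y
    rw [Mm, hd₂, h2, Q_pow_four hω0.le, rate_sq hα4, source, source]
    ring
  · rw [add_sub_right_comm]
    exact (abs_add_le _ _).trans (hbound y)
  · rw [sub_right_comm]
    exact (abs_sub _ _).trans (hbound y)
end

section
/- Let ω > 0, λ ∈ ℝ, and let W₁, W₂ : ℝ → ℝ be smooth functions with W₂(y) > 0 for all y, satisfying M₊W₁ = λ·W₂ and M₋W₂ = λ·W₁ on ℝ. Define the operator U f = f' − (W₂'/W₂)·f and the functions K₂ = 1 − λ·W₁/W₂ + 3·W₂''/W₂ − 4·(W₂'/W₂)² − (ω/3)·Q_ω⁴; K₁ = −3λ·W₁'/W₂ + 3λ·W₁W₂'/W₂² + 3·W₂'''/W₂ − 11·W₂'W₂''/W₂² + 8·(W₂')³/W₂³ − (ω/3)·(Q_ω⁴)'; K₀ = −2λ·W₁''/W₂ + 5λ·W₁'W₂'/W₂² + 2·(W₂')²/W₂² − 3λ·W₁(W₂')²/W₂³ + λ·W₁W₂''/W₂² − W₂''/W₂ + W₂''''/W₂ − 5·(W₂'/W₂)·(W₂'''/W₂)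 − 3·(W₂'')²/W₂² + 15·(W₂''/W₂)·((W₂')²/W₂²) − 8·(W₂')⁴/W₂⁴ − (ω/3)·(Q_ω⁴)'·W₂'/W₂ − (ω/3)·Q_ω⁴·W₂''/W₂ + (2ω/3)·Q_ω⁴·(W₂')²/W₂² + λ² − 1. Then for every smooth function h : ℝ → ℝ, writing r = U h, one has U(M₊(M₋ h)) = r'''' − 2r'' + K₂·r'' + K₁·r' + (K₀ + 1)·r pointwise on ℝ. -/
open Real

/-- The operator `U f = f' - (W₂'/W₂) f`. -/
noncomputable def Uop (W₂ : ℝ → ℝ) (f : ℝ → ℝ) : ℝ → ℝ :=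
  fun y => deriv f y - (deriv W₂ y / W₂ y) * f y

/-- The potential `K₂`. -/
noncomputable def K2 (ω lam : ℝ) (W₁ W₂ : ℝ → ℝ) (y : ℝ) : ℝ :=
  1 - lam * W₁ y / W₂ y + 3 * deriv (deriv W₂) y / W₂ y
    - 4 * (deriv W₂ y / W₂ y) ^ 2 - (ω / 3) * (Q ω y) ^ 4

/-- The potential `K₁`. -/
noncomputable def K1 (ω lam : ℝ) (W₁ W₂ : ℝ → ℝ) (y : ℝ) : ℝ :=
  -3 * lam * deriv W₁ y / W₂ y + 3 * lam * W₁ y * deriv W₂ y / (W₂ y) ^ 2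
    + 3 * deriv (deriv (deriv W₂)) y / W₂ y
    - 11 * deriv W₂ y * deriv (deriv W₂) y / (W₂ y) ^ 2
    + 8 * (deriv W₂ y) ^ 3 / (W₂ y) ^ 3
    - (ω / 3) * deriv (fun z => (Q ω z) ^ 4) y

/-- The potential `K₀`. -/
noncomputable def K0 (ω lam : ℝ) (W₁ W₂ : ℝ → ℝ) (y : ℝ) : ℝ :=
  -2 * lam * deriv (deriv W₁) y / W₂ y
    + 5 * lam * deriv W₁ y * deriv W₂ y / (W₂ y) ^ 2
    + 2 * (deriv W₂ y) ^ 2 / (W₂ y) ^ 2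
    - 3 * lam * W₁ y * (deriv W₂ y) ^ 2 / (W₂ y) ^ 3
    + lam * W₁ y * deriv (deriv W₂) y / (W₂ y) ^ 2
    - deriv (deriv W₂) y / W₂ y
    + deriv (deriv (deriv (deriv W₂))) y / W₂ y
    - 5 * (deriv W₂ y / W₂ y) * (deriv (deriv (deriv W₂)) y / W₂ y)
    - 3 * (deriv (deriv W₂) y) ^ 2 / (W₂ y) ^ 2
    + 15 * (deriv (deriv W₂) y / W₂ y) * ((deriv W₂ y) ^ 2 / (W₂ y) ^ 2)
    - 8 * (deriv W₂ y) ^ 4 / (W₂ y) ^ 4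
    - (ω / 3) * deriv (fun z => (Q ω z) ^ 4) y * (deriv W₂ y / W₂ y)
    - (ω / 3) * (Q ω y) ^ 4 * (deriv (deriv W₂) y / W₂ y)
    + (2 * ω / 3) * (Q ω y) ^ 4 * ((deriv W₂ y) ^ 2 / (W₂ y) ^ 2)
    + lam ^ 2 - 1

theorem Q_pow_four (ω y : ℝ) : Q ω y ^ 4 = (4 / (1 + aCoef ω * Real.cosh (2 * y))) ^ 2 := by
  have hden := one_add_aCoef_mul_cosh_pos ω y
  rw [Q, show (4 : ℕ) = 2 * 2 from rfl, pow_mul, Real.sq_sqrt (by positivity)]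

theorem differentiable_Q_pow_four (ω : ℝ) : Differentiable ℝ fun y => Q ω y ^ 4 := by
  simp only [Q_pow_four]
  intro y
  have hden := (one_add_aCoef_mul_cosh_pos ω y).ne'
  fun_prop (disch := assumption)

theorem ContDiff.deriv_of_top {f : ℝ → ℝ} (hf : ContDiff ℝ (⊤ : ℕ∞) f) :
    ContDiff ℝ (⊤ : ℕ∞) (deriv f) :=
  (contDiff_infty_iff_deriv.mp hf).2

theorem ContDiff.hasDerivAt_of_top {f : ℝ → ℝ} (hf : ContDiff ℝ (⊤ : ℕ∞) f) (y : ℝ) :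
    HasDerivAt f (deriv f y) y :=
  ((contDiff_infty_iff_deriv.mp hf).1 y).hasDerivAt

theorem ContDiff.deriv_mul_of_top {f g : ℝ → ℝ} (hf : ContDiff ℝ (⊤ : ℕ∞) f)
    (hg : ContDiff ℝ (⊤ : ℕ∞) g) :
    deriv (fun y => f y * g y) = fun y => deriv f y * g y + f y * deriv g y :=
  funext fun y => ((hf.hasDerivAt_of_top y).mul (hg.hasDerivAt_of_top y)).deriv

theorem ContDiff.deriv_add_of_top {f g : ℝ → ℝ} (hf : ContDiff ℝ (⊤ : ℕ∞) f)
    (hg : ContDiff ℝ (⊤ : ℕ∞) g) :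
    deriv (fun y => f y + g y) = fun y => deriv f y + deriv g y :=
  funext fun y => ((hf.hasDerivAt_of_top y).add (hg.hasDerivAt_of_top y)).deriv

theorem ContDiff.deriv_deriv_mul_of_top {f g : ℝ → ℝ} (hf : ContDiff ℝ (⊤ : ℕ∞) f)
    (hg : ContDiff ℝ (⊤ : ℕ∞) g) :
    deriv (deriv fun y => f y * g y) =
      fun y => deriv (deriv f) y * g y + 2 * (deriv f y * deriv g y) + f y * deriv (deriv g) y := by
  rw [hf.deriv_mul_of_top hg,
    (hf.deriv_of_top.mul hg).deriv_add_of_top (hf.mul hg.deriv_of_top),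
    hf.deriv_of_top.deriv_mul_of_top hg, hf.deriv_mul_of_top hg.deriv_of_top]
  funext y
  ring

theorem ContDiff.deriv_deriv_deriv_mul_of_top {f g : ℝ → ℝ} (hf : ContDiff ℝ (⊤ : ℕ∞) f)
    (hg : ContDiff ℝ (⊤ : ℕ∞) g) :
    deriv (deriv (deriv fun y => f y * g y)) = fun y =>
      deriv (deriv (deriv f)) y * g y + 3 * (deriv (deriv f) y * deriv g y)
        + 3 * (deriv f y * deriv (deriv g) y) + f y * deriv (deriv (deriv g)) y := by
  have hf₁ := hf.deriv_of_top
  have hg₁ := hg.deriv_of_top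
  rw [hf.deriv_mul_of_top hg, (hf₁.mul hg).deriv_add_of_top (hf.mul hg₁),
    (hf₁.mul hg).deriv_of_top.deriv_add_of_top (hf.mul hg₁).deriv_of_top,
    hf₁.deriv_deriv_mul_of_top hg, hf.deriv_deriv_mul_of_top hg₁]
  funext y
  ring

theorem ContDiff.deriv_deriv_deriv_deriv_mul_of_top {f g : ℝ → ℝ}
    (hf : ContDiff ℝ (⊤ : ℕ∞) f) (hg : ContDiff ℝ (⊤ : ℕ∞) g) :
    deriv (deriv (deriv (deriv fun y => f y * g y))) = fun y =>
      deriv (deriv (deriv (deriv f))) y * g y + 4 * (deriv (deriv (deriv f)) y * deriv g y)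
        + 6 * (deriv (deriv f) y * deriv (deriv g) y)
        + 4 * (deriv f y * deriv (deriv (deriv g)) y)
        + f y * deriv (deriv (deriv (deriv g))) y := by
  have hf₁ := hf.deriv_of_top
  have hg₁ := hg.deriv_of_top
  have hl := hf₁.mul hg
  have hr := hf.mul hg₁
  rw [hf.deriv_mul_of_top hg, hl.deriv_add_of_top hr,
    hl.deriv_of_top.deriv_add_of_top hr.deriv_of_top,
    hl.deriv_of_top.deriv_of_top.deriv_add_of_top hr.deriv_of_top.deriv_of_top,
    hf₁.deriv_deriv_deriv_mul_of_top hg, hf.deriv_deriv_deriv_mul_of_top hg₁]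
  funext y
  ring

/-- On products `W₂ g`, the operator `U` acts as `g ↦ W₂ g'`. -/
theorem Uop_mul {W g : ℝ → ℝ} (hW : ContDiff ℝ (⊤ : ℕ∞) W) (hpos : ∀ y, 0 < W y)
    (hg : ContDiff ℝ (⊤ : ℕ∞) g) :
    Uop W (fun y => W y * g y) = fun y => W y * deriv g y := by
  funext y
  have hy := (hpos y).ne'
  simp only [Uop, hW.deriv_mul_of_top hg]
  field_simp
  ring

theorem Mm_mul {ω lam : ℝ} {W₁ W₂ g : ℝ → ℝ} (hW₂ : ContDiff ℝ (⊤ : ℕ∞) W₂)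
    (heig : ∀ y, Mm ω W₂ y = lam * W₁ y) (hg : ContDiff ℝ (⊤ : ℕ∞) g) :
    Mm ω (fun y => W₂ y * g y) = fun y =>
      lam * (W₁ y * g y) - (deriv (fun z => W₂ z * deriv g z) y + deriv W₂ y * deriv g y) := by
  funext y
  have hy := heig y
  simp only [Mm] at hy
  simp only [Mm, hW₂.deriv_deriv_mul_of_top hg, hW₂.deriv_mul_of_top hg.deriv_of_top]
  linear_combination g y * hy

theorem Mp_mul {ω lam : ℝ} {W₁ W₂ g : ℝ → ℝ} (hW₁ : ContDiff ℝ (⊤ : ℕ∞) W₁)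
    (heig : ∀ y, Mp ω W₁ y = lam * W₂ y) (hg : ContDiff ℝ (⊤ : ℕ∞) g) :
    Mp ω (fun y => W₁ y * g y) = fun y =>
      lam * (W₂ y * g y) - (W₁ y * deriv (deriv g) y + 2 * (deriv W₁ y * deriv g y)) := by
  funext y
  have hy := heig y
  simp only [Mp] at hy
  simp only [Mp, hW₁.deriv_deriv_mul_of_top hg]
  linear_combination g y * hy

theorem Mp_mul_sub (ω c : ℝ) {f g : ℝ → ℝ} (hf : ContDiff ℝ (⊤ : ℕ∞) f)
    (hg : ContDiff ℝ (⊤ : ℕ∞) g) :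
    Mp ω (fun y => c * f y - g y) = fun y => c * Mp ω f y - Mp ω g y := by
  have key : ∀ {u v : ℝ → ℝ}, ContDiff ℝ (⊤ : ℕ∞) u → ContDiff ℝ (⊤ : ℕ∞) v →
      deriv (fun y => c * u y - v y) = fun y => c * deriv u y - deriv v y := fun hu hv =>
    funext fun y => (((hu.hasDerivAt_of_top y).const_mul c).sub (hv.hasDerivAt_of_top y)).deriv
  funext y
  simp only [Mp, key hf hg, key hf.deriv_of_top hg.deriv_of_top]
  ring

/-- Second factorisation: `U M₊ M₋ h = r'''' - 2 r'' + K₂ r'' + K₁ r' + (K₀ + 1) r`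
where `r = U h`. -/
theorem second_factorisation (ω lam : ℝ) (hω : 0 < ω) (W₁ W₂ : ℝ → ℝ)
    (hW₁ : ContDiff ℝ (⊤ : ℕ∞) W₁) (hW₂ : ContDiff ℝ (⊤ : ℕ∞) W₂) (hpos : ∀ y : ℝ, 0 < W₂ y)
    (heig₁ : ∀ y : ℝ, Mp ω W₁ y = lam * W₂ y)
    (heig₂ : ∀ y : ℝ, Mm ω W₂ y = lam * W₁ y)
    (h : ℝ → ℝ) (hh : ContDiff ℝ (⊤ : ℕ∞) h) :
    ∀ y : ℝ,
      Uop W₂ (Mp ω (Mm ω h)) y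
        = deriv (deriv (deriv (deriv (Uop W₂ h)))) y
          - 2 * deriv (deriv (Uop W₂ h)) y
          + K2 ω lam W₁ W₂ y * deriv (deriv (Uop W₂ h)) y
          + K1 ω lam W₁ W₂ y * deriv (Uop W₂ h) y
          + (K0 ω lam W₁ W₂ y + 1) * Uop W₂ h y := by
  obtain ⟨g, hg, rfl⟩ : ∃ g : ℝ → ℝ, ContDiff ℝ (⊤ : ℕ∞) g ∧ (fun y => W₂ y * g y) = h :=
    ⟨fun y => h y / W₂ y, hh.div hW₂ fun y => (hpos y).ne',
      funext fun y => mul_div_cancel₀ _ (hpos y).ne'⟩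
  intro y
  have hp := hg.deriv_of_top
  have hp₁ := hp.deriv_of_top
  have hr := hW₂.mul hp
  have hs := hW₂.deriv_of_top.mul hp
  have hA := hr.deriv_of_top.add hs
  have hq := (differentiable_Q_pow_four ω y).hasDerivAt
  have hA₁ := hr.deriv_of_top.deriv_add_of_top hs
  have hA₂ := hr.deriv_of_top.deriv_of_top.deriv_add_of_top hs.deriv_of_top
  have hA₃ := hr.deriv_of_top.deriv_of_top.deriv_of_top.deriv_add_of_top
    hs.deriv_of_top.deriv_of_top
  rw [← hA₁] at hA₂
  rw [← hA₂] at hA₃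
  have hMpA := ((hA.deriv_of_top.deriv_of_top.hasDerivAt_of_top y).neg.add
    (hA.hasDerivAt_of_top y)).add ((hq.const_mul (ω / 3)).mul (hA.hasDerivAt_of_top y))
  have hM := (((((hW₂.mul hg).hasDerivAt_of_top y).const_mul lam).sub
    (((hW₁.mul hp₁).hasDerivAt_of_top y).add
      (((hW₁.deriv_of_top.mul hp).hasDerivAt_of_top y).const_mul 2))).const_mul lam).sub hMpA
  rw [Uop_mul hW₂ hpos hg, Mm_mul hW₂ heig₂ hg, Mp_mul_sub ω lam (hW₁.mul hg) hA, Mp_mul hW₁ heig₁ hg]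
  refine (congrArg (· - _) hM.deriv).trans ?_
  unfold Mp
  rw [hA₃, hA₂, hA₁, hW₂.deriv_deriv_deriv_deriv_mul_of_top hp,
    hW₂.deriv_deriv_deriv_mul_of_top hp, hW₂.deriv_deriv_mul_of_top hp, hW₂.deriv_mul_of_top hp,
    hW₂.deriv_of_top.deriv_deriv_deriv_mul_of_top hp,
    hW₂.deriv_of_top.deriv_deriv_mul_of_top hp, hW₂.deriv_of_top.deriv_mul_of_top hp,
    hW₂.deriv_mul_of_top hg, hW₁.deriv_mul_of_top hp₁, hW₁.deriv_of_top.deriv_mul_of_top hp]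
  simp only [K2, K1, K0]
  have hy := (hpos y).ne'
  field_simp
  ring
end

section
/- Let K₂, K₁, K₀ : ℝ → ℝ be smooth functions all of whose derivatives are bounded on ℝ. Then for every Schwartz function h : ℝ → ℝ, the virial identity ∫_ℝ (2y·h'(y) + h(y))·(h''''(y) − 2h''(y) + K₂(y)·h''(y) + K₁(y)·h'(y) + (K₀(y)+1)·h(y)) dy = 4∫_ℝ (h'')² + 4∫_ℝ (h')² + ∫_ℝ Y₁·(h')² + ∫_ℝ Y₀·h² holds, where Y₁(y) = −2K₂(y) − y·K₂'(y) + 2y·K₁(y) and Y₀(y) = (1/2)·(K₂''(y) − K₁'(y) − 2y·K₀'(y)). -/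
open Real MeasureTheory

/-- A smooth function on `ℝ` with all derivatives bounded has temperate growth. -/
lemma Function.HasTemperateGrowth.of_bounded_iteratedDeriv {f : ℝ → ℝ}
    (hf : ContDiff ℝ (⊤ : ℕ∞) f) (hb : ∀ k : ℕ, ∃ M : ℝ, ∀ y : ℝ, |iteratedDeriv k f y| ≤ M) :
    f.HasTemperateGrowth := by
  refine ⟨hf, fun n ↦ ?_⟩
  obtain ⟨M, hM⟩ := hb n
  refine ⟨0, M, fun x ↦ ?_⟩
  rw [norm_iteratedFDeriv_eq_norm_iteratedDeriv, Real.norm_eq_abs]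
  simpa using hM x

/-- The derivative of a function of temperate growth on `ℝ` has temperate growth. -/
lemma Function.HasTemperateGrowth.deriv {f : ℝ → ℝ} (hf : f.HasTemperateGrowth) :
    (deriv f).HasTemperateGrowth := by
  refine ⟨(contDiff_infty_iff_deriv.mp hf.1).2, fun n ↦ ?_⟩
  obtain ⟨k, C, h⟩ := hf.2 (n + 1)
  refine ⟨k, C, fun x ↦ ?_⟩
  simpa only [norm_iteratedFDeriv_eq_norm_iteratedDeriv, iteratedDeriv_succ'] using h x

/-- The product of a function of temperate growth and a Schwartz function is integrable. -/
lemma SchwartzMap.integrable_hasTemperateGrowth_mul {g : ℝ → ℝ} (hg : g.HasTemperateGrowth)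
    (f : SchwartzMap ℝ ℝ) : Integrable (fun y ↦ g y * f y) :=
  (SchwartzMap.smulLeftCLM ℝ g f).integrable.congr
    (.of_forall fun y ↦ by simp [SchwartzMap.smulLeftCLM_apply_apply hg])

/-- Virial identity for the fourth order operator
`K h = h'''' - 2h'' + K₂ h'' + K₁ h' + (K₀ + 1) h`:
`∫ (2y h' + h) K h = 4∫ (h'')² + 4∫ (h')² + ∫ Y₁ (h')² + ∫ Y₀ h²` where
`Y₁ = -2K₂ - y K₂' + 2y K₁` and `Y₀ = (K₂'' - K₁' - 2y K₀')/2`. -/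
theorem virial_identity_fourth_order (K₂ K₁ K₀ : ℝ → ℝ)
    (hK₂ : ContDiff ℝ (⊤ : ℕ∞) K₂) (hK₁ : ContDiff ℝ (⊤ : ℕ∞) K₁) (hK₀ : ContDiff ℝ (⊤ : ℕ∞) K₀)
    (hb₂ : ∀ k : ℕ, ∃ M : ℝ, ∀ y : ℝ, |iteratedDeriv k K₂ y| ≤ M)
    (hb₁ : ∀ k : ℕ, ∃ M : ℝ, ∀ y : ℝ, |iteratedDeriv k K₁ y| ≤ M)
    (hb₀ : ∀ k : ℕ, ∃ M : ℝ, ∀ y : ℝ, |iteratedDeriv k K₀ y| ≤ M)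
    (h : SchwartzMap ℝ ℝ) :
    (∫ y : ℝ, (2 * y * deriv (⇑h) y + h y) *
        (deriv (deriv (deriv (deriv (⇑h)))) y - 2 * deriv (deriv (⇑h)) y
          + K₂ y * deriv (deriv (⇑h)) y + K₁ y * deriv (⇑h) y + (K₀ y + 1) * h y))
      = 4 * (∫ y : ℝ, (deriv (deriv (⇑h)) y) ^ 2)
        + 4 * (∫ y : ℝ, (deriv (⇑h) y) ^ 2)
        + (∫ y : ℝ, (-2 * K₂ y - y * deriv K₂ y + 2 * y * K₁ y) * (deriv (⇑h) y) ^ 2)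
        + (∫ y : ℝ, (1 / 2) * (deriv (deriv K₂) y - deriv K₁ y - 2 * y * deriv K₀ y)
            * (h y) ^ 2) := by
  have t₂ := Function.HasTemperateGrowth.of_bounded_iteratedDeriv hK₂ hb₂
  have t₁ := Function.HasTemperateGrowth.of_bounded_iteratedDeriv hK₁ hb₁
  have t₀ := Function.HasTemperateGrowth.of_bounded_iteratedDeriv hK₀ hb₀
  have t₂' := t₂.deriv
  have t₂'' := t₂'.deriv
  have t₁' := t₁.deriv
  have t₀' := t₀.deriv
  have d {K : ℝ → ℝ} (hK : K.HasTemperateGrowth) (y : ℝ) : HasDerivAt K (deriv K y) y :=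
    (hK.1.differentiable (by simp) y).hasDerivAt
  obtain ⟨h₁, e₁⟩ : ∃ g : SchwartzMap ℝ ℝ, deriv ⇑h = ⇑g := ⟨SchwartzMap.derivCLM ℝ ℝ h, rfl⟩
  obtain ⟨h₂, e₂⟩ : ∃ g : SchwartzMap ℝ ℝ, deriv ⇑h₁ = ⇑g := ⟨SchwartzMap.derivCLM ℝ ℝ h₁, rfl⟩
  obtain ⟨h₃, e₃⟩ : ∃ g : SchwartzMap ℝ ℝ, deriv ⇑h₂ = ⇑g := ⟨SchwartzMap.derivCLM ℝ ℝ h₂, rfl⟩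
  obtain ⟨h₄, e₄⟩ : ∃ g : SchwartzMap ℝ ℝ, deriv ⇑h₃ = ⇑g := ⟨SchwartzMap.derivCLM ℝ ℝ h₃, rfl⟩
  simp only [e₁, e₂, e₃, e₄]
  have s := h.hasTemperateGrowth
  have s₁ := h₁.hasTemperateGrowth
  have s₂ := h₂.hasTemperateGrowth
  have s₃ := h₃.hasTemperateGrowth
  have s₄ := h₄.hasTemperateGrowth
  have d₀ (y : ℝ) : HasDerivAt h (h₁ y) y := by simpa only [e₁] using h.hasDerivAt y
  have d₁ (y : ℝ) : HasDerivAt h₁ (h₂ y) y := by simpa only [e₂] using h₁.hasDerivAt y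
  have d₂ (y : ℝ) : HasDerivAt h₂ (h₃ y) y := by simpa only [e₃] using h₂.hasDerivAt y
  have d₃ (y : ℝ) : HasDerivAt h₃ (h₄ y) y := by simpa only [e₄] using h₃.hasDerivAt y
  have iL : Integrable fun y ↦ (2 * y * h₁ y + h y) *
      (h₄ y - 2 * h₂ y + K₂ y * h₂ y + K₁ y * h₁ y + (K₀ y + 1) * h y) := by
    have i := h₁.integrable_hasTemperateGrowth_mul (g := fun y ↦ 2 * y *
      (h₄ y - 2 * h₂ y + K₂ y * h₂ y + K₁ y * h₁ y + (K₀ y + 1) * h y)) (by fun_prop)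
    have j := h.integrable_hasTemperateGrowth_mul (g := fun y ↦
      h₄ y - 2 * h₂ y + K₂ y * h₂ y + K₁ y * h₁ y + (K₀ y + 1) * h y) (by fun_prop)
    exact (i.add j).congr (.of_forall fun y ↦ by simp only [Pi.add_apply]; ring)
  have sq {g : ℝ → ℝ} (hg : g.HasTemperateGrowth) (f : SchwartzMap ℝ ℝ) :
      Integrable fun y ↦ g y * (f y) ^ 2 := by
    have sf := f.hasTemperateGrowth
    have i := f.integrable_hasTemperateGrowth_mul (g := fun y ↦ g y * f y) (by fun_prop)
    exact i.congr (.of_forall fun y ↦ by ring)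
  have i₂ := sq (g := fun _ ↦ 4) (by fun_prop) h₂
  have i₁ := sq (g := fun _ ↦ 4) (by fun_prop) h₁
  have iY₁ := sq (g := fun y ↦ -2 * K₂ y - y * deriv K₂ y + 2 * y * K₁ y) (by fun_prop) h₁
  have iY₀ := sq (g := fun y ↦ (1 / 2) * (deriv (deriv K₂) y - deriv K₁ y - 2 * y * deriv K₀ y))
    (by fun_prop) h
  have iR := ((i₂.fun_add i₁).fun_add iY₁).fun_add iY₀
  rw [← integral_const_mul, ← integral_const_mul, ← integral_add i₂ i₁,
    ← integral_add (i₂.fun_add i₁) iY₁, ← integral_add ((i₂.fun_add i₁).fun_add iY₁) iY₀,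
    ← sub_eq_zero, ← integral_sub iL iR]
  -- The difference of the two integrands is the derivative of an explicit integrable function.
  refine integral_eq_zero_of_hasDerivAt_of_integrable
    (f := fun y ↦ (h₃ y - 2 * h₁ y + K₂ y * h₁ y
        + (-(1 / 2) * deriv K₂ y + (1 / 2) * K₁ y + y * (K₀ y + 1)) * h y) * h y
      + (2 * y * h₃ y - 3 * h₂ y - 2 * y * h₁ y + y * K₂ y * h₁ y) * h₁ y
      + (-(y * h₂ y)) * h₂ y)
    (fun y ↦ ?_) (iL.sub iR) ?_
  · have dy := hasDerivAt_id' y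
    have D := (((((d₃ y).sub ((d₁ y).const_mul 2)).add ((d t₂ y).mul (d₁ y))).add
        (((((d t₂' y).const_mul (-(1 / 2))).add ((d t₁ y).const_mul (1 / 2))).add
          (dy.mul ((d t₀ y).add_const 1))).mul (d₀ y))).mul (d₀ y)).add
      ((((((dy.const_mul 2).mul (d₃ y)).sub ((d₂ y).const_mul 3)).sub
        ((dy.const_mul 2).mul (d₁ y))).add ((dy.mul (d t₂ y)).mul (d₁ y))).mul (d₁ y)) |>.add
      ((dy.mul (d₂ y)).neg.mul (d₂ y))
    refine D.congr_deriv ?_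
    simp only [Pi.add_apply, Pi.sub_apply, Pi.mul_apply, Pi.neg_apply]
    ring
  · exact ((h.integrable_hasTemperateGrowth_mul (by fun_prop)).add
      (h₁.integrable_hasTemperateGrowth_mul (by fun_prop))).add
      (h₂.integrable_hasTemperateGrowth_mul (by fun_prop))
end

section
/- For every y ∈ ℝ, −(1/6)·∫_ℝ |y − z|·Q₀(z)⁴ dz = (1/9)·Q₀(y)² + (8/9)·ln(Q₀(y)/√8). -/
open Real

/-- `Q₀(y) = √2 / cosh y`. -/
noncomputable def Q0 (y : ℝ) : ℝ := Real.sqrt 2 / Real.cosh y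

open MeasureTheory Set Filter Topology

lemma Q0_pow_four (z : ℝ) : Q0 z ^ 4 = 4 / cosh z ^ 4 := by
  have h : Real.sqrt 2 ^ 4 = 4 := by
    rw [show (4 : ℕ) = 2 * 2 from rfl, pow_mul, Real.sq_sqrt (by norm_num)]; norm_num
  rw [Q0, div_pow, h]

lemma Q0_neg (z : ℝ) : Q0 (-z) = Q0 z := by
  rw [Q0, Q0, cosh_neg]

/-- A primitive of `z ↦ (z - y) * Q0 z ^ 4`. -/
noncomputable def momentPrimitive (y z : ℝ) : ℝ :=
  4 * ((z - y) * (sinh z / cosh z - (sinh z / cosh z) ^ 3 / 3)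
    - (2 / 3 * log (cosh z) - 1 / 6 / cosh z ^ 2))

lemma hasDerivAt_momentPrimitive (y z : ℝ) :
    HasDerivAt (momentPrimitive y) ((z - y) * Q0 z ^ 4) z := by
  have hc : cosh z ≠ 0 := (cosh_pos z).ne'
  have ht := (hasDerivAt_sinh z).div (hasDerivAt_cosh z) hc
  have hl := ((hasDerivAt_cosh z).log hc).const_mul (2 / 3)
  have hs := (hasDerivAt_const z (1 / 6 : ℝ)).div ((hasDerivAt_cosh z).pow 2) (pow_ne_zero 2 hc)
  have h := ((((hasDerivAt_id z).sub_const y).mul (ht.sub ((ht.pow 3).div_const 3))).sub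
    (hl.sub hs)).const_mul 4
  refine h.congr_deriv ?_
  rw [Q0_pow_four]
  simp only [Pi.sub_apply, Pi.div_apply, Pi.pow_apply, id]
  have hsq : cosh z * cosh z - sinh z * sinh z = 1 := by
    linear_combination cosh_sq_sub_sinh_sq z
  rw [hsq]
  generalize sinh z = s at *
  generalize cosh z = c at *
  push_cast
  field_simp
  linear_combination (6 * s * c + 18 * (z - y)) * hsq

lemma momentPrimitive_eq_exp (y z : ℝ) :
    momentPrimitive y z = 4 * (-(4 / 3) * (z * exp (-2 * z) - y * exp (-2 * z)) * exp (-2 * z)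
        * (3 + exp (-2 * z)) / (1 + exp (-2 * z)) ^ 3
      - 2 / 3 * y - 2 / 3 * log (1 + exp (-2 * z)) + 2 / 3 * log 2
      + 2 / 3 * exp (-2 * z) / (1 + exp (-2 * z)) ^ 2) := by
  have hu : exp (-2 * z) = exp (-z) ^ 2 := by rw [← exp_nat_mul]; congr 1; push_cast; ring
  have he : exp z * exp (-z) = 1 := by rw [← exp_add]; simp
  have hp : 0 < 1 + exp (-2 * z) := by positivity
  have hcosh : cosh z = exp z * (1 + exp (-2 * z)) / 2 := by
    rw [cosh_eq, hu]; linear_combination (-exp (-z) / 2) * he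
  have hsinh : sinh z = exp z * (1 - exp (-2 * z)) / 2 := by
    rw [sinh_eq, hu]; linear_combination (exp (-z) / 2) * he
  have hlog : log (cosh z) = z + log (1 + exp (-2 * z)) - log 2 := by
    rw [hcosh, log_div (by positivity) (by norm_num), log_mul (exp_ne_zero z) hp.ne', log_exp]
  have ht : sinh z / cosh z = (1 - exp (-2 * z)) / (1 + exp (-2 * z)) := by
    rw [hsinh, hcosh]; field_simp
  have hs : 1 / 6 / cosh z ^ 2 = 2 / 3 * exp (-2 * z) / (1 + exp (-2 * z)) ^ 2 := by
    have h2 : exp z ^ 2 * exp (-2 * z) = 1 := by rw [hu, ← mul_pow, he, one_pow]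
    have := exp_pos z
    rw [hcosh, div_eq_div_iff (by positivity) (by positivity)]
    linear_combination (-(1 + exp (-2 * z)) ^ 2 / 6) * h2
  rw [momentPrimitive, hlog, ht, hs]
  field_simp
  ring

lemma tendsto_momentPrimitive (y : ℝ) :
    Tendsto (momentPrimitive y) atTop (𝓝 (4 * (2 / 3 * log 2 - 2 / 3 * y))) := by
  have hu : Tendsto (fun z : ℝ => exp (-2 * z)) atTop (𝓝 0) :=
    tendsto_exp_atBot.comp (tendsto_id.const_mul_atTop_of_neg (by norm_num))
  have hzu : Tendsto (fun z : ℝ => z * exp (-2 * z)) atTop (𝓝 0) := by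
    simpa using tendsto_rpow_mul_exp_neg_mul_atTop_nhds_zero 1 2 (by norm_num)
  have h1 : Tendsto (fun z : ℝ => 1 + exp (-2 * z)) atTop (𝓝 (1 + 0)) := hu.const_add 1
  have hlog := h1.log (by norm_num)
  have hA := ((((hzu.sub (hu.const_mul y)).const_mul (-(4 / 3))).mul hu).mul
    (hu.const_add 3)).div (h1.pow 3) (by norm_num)
  have hB := (hu.const_mul (2 / 3)).div (h1.pow 2) (by norm_num)
  have h := (((((hA.sub_const (2 / 3 * y)).sub (hlog.const_mul (2 / 3))).add_const
    (2 / 3 * log 2)).add hB).const_mul 4)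
  rw [show momentPrimitive y = _ from funext (momentPrimitive_eq_exp y)]
  convert h using 2
  · rfl
  · simp only [add_zero, log_one]
    ring

lemma integrableOn_Ioi_moment (y : ℝ) :
    IntegrableOn (fun z => |y - z| * Q0 z ^ 4) (Ioi y) := by
  refine IntegrableOn.congr_fun (f := fun z => (z - y) * Q0 z ^ 4) ?_ ?_ measurableSet_Ioi
  · refine integrableOn_Ioi_deriv_of_nonneg' (fun z _ => hasDerivAt_momentPrimitive y z) ?_
      (tendsto_momentPrimitive y)
    intro z hz
    have := sub_pos.2 (mem_Ioi.1 hz)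
    positivity
  · intro z hz
    simp only [abs_sub_comm y z, abs_of_pos (sub_pos.2 (mem_Ioi.1 hz))]

lemma integral_Ioi_moment (y : ℝ) :
    ∫ z in Ioi y, |y - z| * Q0 z ^ 4
      = 4 * (2 / 3 * log 2 - 2 / 3 * y + 2 / 3 * log (cosh y) - 1 / 6 / cosh y ^ 2) := by
  have h : ∫ z in Ioi y, |y - z| * Q0 z ^ 4 = ∫ z in Ioi y, (z - y) * Q0 z ^ 4 := by
    refine setIntegral_congr_fun measurableSet_Ioi fun z hz => ?_
    simp only [abs_sub_comm y z, abs_of_pos (sub_pos.2 (mem_Ioi.1 hz))]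
  rw [h, integral_Ioi_of_hasDerivAt_of_nonneg'
    (fun z _ => hasDerivAt_momentPrimitive y z) ?_ (tendsto_momentPrimitive y), momentPrimitive]
  · ring
  · intro z hz
    have := sub_pos.2 (mem_Ioi.1 hz)
    positivity

lemma moment_neg (y z : ℝ) : |-y - -z| * Q0 (-z) ^ 4 = |y - z| * Q0 z ^ 4 := by
  rw [Q0_neg, ← abs_neg (y - z)]; congr 2; ring

lemma integrableOn_Iic_moment (y : ℝ) :
    IntegrableOn (fun z => |y - z| * Q0 z ^ 4) (Iic y) := by
  have h := ((integrableOn_Ici_iff_integrableOn_Ioi).2 (integrableOn_Ioi_moment (-y))).comp_neg_Iic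
  simpa only [moment_neg] using h

lemma integral_Iic_moment (y : ℝ) :
    ∫ z in Iic y, |y - z| * Q0 z ^ 4 = ∫ z in Ioi (-y), |-y - z| * Q0 z ^ 4 := by
  rw [← integral_comp_neg_Iic]
  simp only [moment_neg]

/-- Explicit formula for the convolution `-(1/6) ∫ |y - z| Q₀(z)⁴ dz`. -/
theorem convolution_formula (y : ℝ) :
    -(1 / 6) * (∫ z : ℝ, |y - z| * (Q0 z) ^ 4)
      = (1 / 9) * (Q0 y) ^ 2 + (8 / 9) * Real.log (Q0 y / Real.sqrt 8) := by
  have hlog : log (Q0 y / Real.sqrt 8) = -log 2 - log (cosh y) := by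
    have h8 : Real.sqrt 8 = 2 * Real.sqrt 2 := by
      rw [show (8 : ℝ) = 2 ^ 2 * 2 by norm_num, Real.sqrt_mul (by norm_num),
        Real.sqrt_sq (by norm_num)]
    have hc := cosh_pos y
    have h : Q0 y / Real.sqrt 8 = (2 * cosh y)⁻¹ := by
      rw [Q0, h8]; field_simp
    rw [h, log_inv, log_mul (by norm_num) hc.ne']
    ring
  have hsq : Q0 y ^ 2 = 2 / cosh y ^ 2 := by
    rw [Q0, div_pow, Real.sq_sqrt (by norm_num)]
  rw [← setIntegral_univ, ← Iic_union_Ioi (a := y),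
    setIntegral_union (Iic_disjoint_Ioi le_rfl) measurableSet_Ioi (integrableOn_Iic_moment y)
      (integrableOn_Ioi_moment y), integral_Iic_moment, integral_Ioi_moment, integral_Ioi_moment,
    cosh_neg, hlog, hsq]
  ring
end

section
/- For every integer k ≥ 1, setting p_k = ∫_ℝ Q₀(y)^k·cos(y) dy, one has p_{k+2} = (2(k² + 1)/(k(k+1)))·p_k. -/
open Real

open MeasureTheory

lemma one_add_sq_div_two_le_cosh (y : ℝ) : 1 + y ^ 2 / 2 ≤ Real.cosh y := by
  have h : Real.cosh y = Real.cosh (y / 2) ^ 2 + Real.sinh (y / 2) ^ 2 := by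
    rw [← Real.cosh_two_mul]
    congr 1
    ring
  have hle : (y / 2) ^ 2 ≤ Real.sinh (y / 2) ^ 2 := by
    rw [sq_le_sq, Real.abs_sinh]
    exact Real.self_le_sinh_iff.mpr (abs_nonneg _)
  rw [h, Real.cosh_sq]
  linarith

lemma abs_sinh_div_cosh_le_one (y : ℝ) : |Real.sinh y / Real.cosh y| ≤ 1 := by
  rw [← Real.tanh_eq_sinh_div_cosh]
  exact (Real.abs_tanh_lt_one y).le

lemma continuous_Q0 : Continuous Q0 :=
  continuous_const.div Real.continuous_cosh fun y => (Real.cosh_pos y).ne'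

lemma Q0_nonneg (y : ℝ) : 0 ≤ Q0 y :=
  div_nonneg (Real.sqrt_nonneg 2) (Real.cosh_pos y).le

lemma Q0_le_sqrt_two (y : ℝ) : Q0 y ≤ Real.sqrt 2 :=
  div_le_self (Real.sqrt_nonneg 2) (Real.one_le_cosh y)

lemma integrable_Q0 : Integrable Q0 := by
  refine (integrable_inv_one_add_sq.const_mul (Real.sqrt 2 * 2)).mono'
    continuous_Q0.aestronglyMeasurable (ae_of_all _ fun y => ?_)
  rw [Real.norm_of_nonneg (Q0_nonneg y), Q0, mul_assoc, div_eq_mul_inv]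
  gcongr
  rw [← div_eq_mul_inv, inv_eq_one_div,
    div_le_div_iff₀ (Real.cosh_pos y) (by positivity)]
  linarith [one_add_sq_div_two_le_cosh y]

lemma integrable_Q0_pow_mul {k : ℕ} (hk : 1 ≤ k) {g : ℝ → ℝ} (hg : Continuous g) {C : ℝ}
    (hC : ∀ y, |g y| ≤ C) : Integrable fun y => Q0 y ^ k * g y := by
  obtain ⟨m, rfl⟩ := Nat.exists_eq_add_of_le' hk
  refine (integrable_Q0.const_mul (Real.sqrt 2 ^ m * C)).mono'
    ((continuous_Q0.pow _).mul hg).aestronglyMeasurable (ae_of_all _ fun y => ?_)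
  have h0 := Q0_nonneg y
  rw [Real.norm_eq_abs, abs_mul, abs_of_nonneg (pow_nonneg h0 _), pow_succ, mul_right_comm]
  gcongr
  · exact Q0_le_sqrt_two y
  · exact hC y

lemma hasDerivAt_Q0 (y : ℝ) :
    HasDerivAt Q0 (-(Q0 y * (Real.sinh y / Real.cosh y))) y := by
  have hc := (Real.cosh_pos y).ne'
  refine ((hasDerivAt_const y (Real.sqrt 2)).div (Real.hasDerivAt_cosh y) hc).congr_deriv ?_
  rw [Q0]
  field_simp
  ring

lemma hasDerivAt_sinh_div_cosh (y : ℝ) :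
    HasDerivAt (fun y => Real.sinh y / Real.cosh y) (Q0 y ^ 2 / 2) y := by
  have hc := (Real.cosh_pos y).ne'
  refine ((Real.hasDerivAt_sinh y).div (Real.hasDerivAt_cosh y) hc).congr_deriv ?_
  rw [Q0, div_pow, Real.sq_sqrt zero_le_two]
  field_simp
  rw [Real.cosh_sq]
  ring

lemma sinh_div_cosh_sq (y : ℝ) : (Real.sinh y / Real.cosh y) ^ 2 = 1 - Q0 y ^ 2 / 2 := by
  have hc := (Real.cosh_pos y).ne'
  rw [Q0, div_pow, div_pow, Real.sq_sqrt zero_le_two]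
  field_simp
  rw [Real.cosh_sq]
  ring

lemma hasDerivAt_Q0_pow_mul {k : ℕ} (hk : 1 ≤ k) (y : ℝ) :
    HasDerivAt
      (fun y => Q0 y ^ k * (Real.sin y - k * (Real.sinh y / Real.cosh y * Real.cos y)))
      (((k : ℝ) ^ 2 + 1) * (Q0 y ^ k * Real.cos y)
        - (k : ℝ) * (k + 1) / 2 * (Q0 y ^ (k + 2) * Real.cos y)) y := by
  obtain ⟨m, rfl⟩ := Nat.exists_eq_add_of_le' hk
  refine (((hasDerivAt_Q0 y).pow (m + 1)).mul ((Real.hasDerivAt_sin y).sub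
    (((hasDerivAt_sinh_div_cosh y).mul (Real.hasDerivAt_cos y)).const_mul
      ((m + 1 : ℕ) : ℝ)))).congr_deriv ?_
  have hT := sinh_div_cosh_sq y
  simp only [Pi.pow_apply, Pi.mul_apply, Pi.sub_apply, Nat.add_sub_cancel]
  generalize Real.sinh y / Real.cosh y = T at hT ⊢
  push_cast
  linear_combination (((m : ℝ) + 1) ^ 2 * Q0 y ^ (m + 1) * Real.cos y) * hT

/-- The recurrence `p_{k+2} = (2(k²+1)/(k(k+1))) p_k` for
`p_k = ∫ Q₀^k cos`. -/
theorem p_recurrence (k : ℕ) (hk : 1 ≤ k) :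
    (∫ y : ℝ, (Q0 y) ^ (k + 2) * Real.cos y)
      = (2 * ((k : ℝ) ^ 2 + 1) / ((k : ℝ) * ((k : ℝ) + 1)))
        * ∫ y : ℝ, (Q0 y) ^ k * Real.cos y := by
  have hcos : ∀ n : ℕ, 1 ≤ n → Integrable fun y => Q0 y ^ n * Real.cos y := fun n hn =>
    integrable_Q0_pow_mul hn Real.continuous_cos Real.abs_cos_le_one
  have h1 := (hcos k hk).const_mul ((k : ℝ) ^ 2 + 1)
  have h2 := (hcos (k + 2) (by lia)).const_mul ((k : ℝ) * (k + 1) / 2)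
  have hF : Integrable fun y =>
      Q0 y ^ k * (Real.sin y - k * (Real.sinh y / Real.cosh y * Real.cos y)) := by
    refine integrable_Q0_pow_mul (C := 1 + k * (1 * 1)) hk ?_ fun y => ?_
    · exact Real.continuous_sin.sub (continuous_const.mul ((Real.continuous_sinh.div
        Real.continuous_cosh fun y => (Real.cosh_pos y).ne').mul Real.continuous_cos))
    · refine (abs_sub _ _).trans ?_
      rw [abs_mul, abs_mul, Nat.abs_cast]
      gcongr
      · exact Real.abs_sin_le_one y
      · exact abs_sinh_div_cosh_le_one y
      · exact Real.abs_cos_le_one y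
  have h := integral_eq_zero_of_hasDerivAt_of_integrable (hasDerivAt_Q0_pow_mul hk)
    (h1.sub h2) hF
  rw [integral_sub h1 h2, integral_const_mul, integral_const_mul] at h
  have hk0 : (0 : ℝ) < k := by exact_mod_cast hk
  rw [div_mul_eq_mul_div, eq_div_iff (by positivity)]
  linarith
end

section
/- Let f(y) = 1 − Q₀(y)² and g(y) = 1 (the constant function). Then for all y ∈ ℝ: −f''(y) + f(y) − 3Q₀(y)²·f(y) = 1 and −g''(y) + g(y) − Q₀(y)²·g(y) = 1 − Q₀(y)²; that is, the pair (1 − Q₀², 1) is a resonance at eigenvalue 1 of the linearized system at ω = 0: (−∂² + 1 − 3Q₀²)(1 − Q₀²) = 1 and (−∂² + 1 − Q₀²)·1 = 1 − Q₀². -/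
open Real

theorem Q0_sq (y : ℝ) : Q0 y ^ 2 = 2 / cosh y ^ 2 := by
  rw [Q0, div_pow, sq_sqrt zero_le_two]

theorem hasDerivAt_one_sub_Q0_sq (y : ℝ) :
    HasDerivAt (fun x => 1 - Q0 x ^ 2) (4 * sinh y / cosh y ^ 3) y := by
  have hc : cosh y ≠ 0 := (cosh_pos y).ne'
  simp only [Q0_sq]
  refine (((hasDerivAt_const y 2).div ((hasDerivAt_cosh y).pow 2)
    (pow_ne_zero 2 hc)).const_sub 1).congr_deriv ?_
  simp only [Pi.pow_apply]
  field_simp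
  ring

theorem hasDerivAt_deriv_one_sub_Q0_sq (y : ℝ) :
    HasDerivAt (deriv fun x => 1 - Q0 x ^ 2) (12 / cosh y ^ 4 - 8 / cosh y ^ 2) y := by
  have hc : cosh y ≠ 0 := (cosh_pos y).ne'
  rw [funext fun x => (hasDerivAt_one_sub_Q0_sq x).deriv]
  refine (((hasDerivAt_sinh y).const_mul 4).div ((hasDerivAt_cosh y).pow 3)
    (pow_ne_zero 3 hc)).congr_deriv ?_
  simp only [Pi.pow_apply]
  field_simp
  linear_combination (-12) * cosh y ^ 2 * sinh_sq y

/-- The pair `(1 - Q₀², 1)` is a resonance at eigenvalue `1` of the linearized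
system at `ω = 0`: `(-∂² + 1 - 3Q₀²)(1 - Q₀²) = 1` and
`(-∂² + 1 - Q₀²) 1 = 1 - Q₀²`. -/
theorem resonance_identities :
    (∀ y : ℝ,
      -(deriv (deriv (fun x => 1 - (Q0 x) ^ 2)) y) + (1 - (Q0 y) ^ 2)
        - 3 * (Q0 y) ^ 2 * (1 - (Q0 y) ^ 2) = 1) ∧
    (∀ y : ℝ,
      -(deriv (deriv (fun _ : ℝ => (1 : ℝ))) y) + (1 : ℝ)
        - (Q0 y) ^ 2 * 1 = 1 - (Q0 y) ^ 2) := by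
  refine ⟨fun y => ?_, fun y => by simp⟩
  have hc : cosh y ≠ 0 := (cosh_pos y).ne'
  rw [(hasDerivAt_deriv_one_sub_Q0_sq y).deriv, Q0_sq]
  field_simp
  ring
end
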